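/- arXiv:1412.2654 — 2 statements merged into one kernel-verified Lean document; each statement's English description precedes it below -/
import Mathlib

section
/- Let R be a Cohen-Macaulay commutative noetherian ring with a dualizing module D, and let G be a Gorenstein injective R-module. Then the small support of G equals {p ∈ Spec(R) | G_{(p)} ≠ 0}, where G_{(p)} := Tor_{ht(p)}^R(Hom_R(D, E_R(R/p)), G). -/
/-!
Common definitions: property t(p), injective hulls, (C-)Gorenstein injective modules,
(C-)Gorenstein injective / injective / flat dimensions, small support, torsion functor,
Tor and Ext modules, semidualizing and dualizing modules, depth, Cohen-Macaulay rings,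
Serre's condition (S₁), Gorenstein local rings, minimal injective resolutions.
-/

universe u

open CategoryTheory Limits DirectSum

noncomputable section

/-- An `R`-module `S` has property `t(p)`: multiplication by every `r ∉ p` is bijective on `S`,
and every element of `S` is annihilated by a power of `p`. -/
def PropT (R : Type u) [CommRing R] (p : Ideal R) (S : Type u) [AddCommGroup S]
    [Module R S] : Prop :=
  (∀ r : R, r ∉ p → Function.Bijective (fun s : S => r • s)) ∧
  (∀ x : S, ∃ m : ℕ, 0 < m ∧ ∀ a ∈ p ^ m, a • x = 0)

/-- `E` is an injective hull of `N` over `R`: `E` is injective and `N` embeds in `E` as an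
essential submodule. -/
def IsInjectiveHull (R : Type u) [CommRing R] (N : Type u) [AddCommGroup N] [Module R N]
    (E : Type u) [AddCommGroup E] [Module R E] : Prop :=
  Module.Injective R E ∧ ∃ ι : N →ₗ[R] E, Function.Injective ι ∧
    ∀ K : Submodule R E, K ≠ ⊥ → K ⊓ LinearMap.range ι ≠ ⊥

/-- A complete injective resolution: a doubly infinite exact sequence of injective modules
which stays exact after applying `Hom_R(-, I)` for every injective module `I`. -/
structure CompleteInjRes (R : Type u) [CommRing R] where
  E : ℤ → Type u
  [acg : ∀ i, AddCommGroup (E i)]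
  [mod : ∀ i, Module R (E i)]
  d : ∀ i, E i →ₗ[R] E (i + 1)
  inj : ∀ i, Module.Injective R (E i)
  exct : ∀ i, LinearMap.range (d i) = LinearMap.ker (d (i + 1))
  homExact : ∀ (I : Type u) [AddCommGroup I] [Module R I], Module.Injective R I →
    ∀ (i : ℤ) (g : E (i + 1) →ₗ[R] I), g ∘ₗ d i = 0 →
      ∃ h : E (i + 1 + 1) →ₗ[R] I, h ∘ₗ d (i + 1) = g

attribute [instance] CompleteInjRes.acg CompleteInjRes.mod

/-- `G` is a Gorenstein injective `R`-module: it is the image of some map in a complete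
injective resolution. -/
def GorensteinInjective (R : Type u) [CommRing R] (G : Type u) [AddCommGroup G]
    [Module R G] : Prop :=
  ∃ X : CompleteInjRes R, Nonempty (G ≃ₗ[R] LinearMap.range (X.d 0))

/-- A complete `I_C I`-resolution: an exact sequence
`⋯ → Hom(C,I₁) → Hom(C,I₀) → I⁰ → I¹ → ⋯` (terms in nonnegative degrees are injective,
terms in negative degrees are of the form `Hom_R(C, I)` with `I` injective) such that
`Hom_R(Hom_R(C,J), -)` leaves it exact for every injective `R`-module `J`. -/
structure CompleteICIRes (R : Type u) [CommRing R] (C : Type u) [AddCommGroup C]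
    [Module R C] where
  X : ℤ → Type u
  [acg : ∀ i, AddCommGroup (X i)]
  [mod : ∀ i, Module R (X i)]
  d : ∀ i, X i →ₗ[R] X (i + 1)
  exct : ∀ i, LinearMap.range (d i) = LinearMap.ker (d (i + 1))
  injPos : ∀ i : ℤ, 0 ≤ i → Module.Injective R (X i)
  homCInjNeg : ∀ i : ℤ, i < 0 → ∃ (I : Type u) (_ : AddCommGroup I) (_ : Module R I),
    Module.Injective R I ∧ Nonempty (X i ≃ₗ[R] (C →ₗ[R] I))
  homExact : ∀ (J : Type u) [AddCommGroup J] [Module R J], Module.Injective R J →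
    ∀ (i : ℤ) (g : (C →ₗ[R] J) →ₗ[R] X (i + 1)), d (i + 1) ∘ₗ g = 0 →
      ∃ h : (C →ₗ[R] J) →ₗ[R] X i, d i ∘ₗ h = g

attribute [instance] CompleteICIRes.acg CompleteICIRes.mod

/-- `G` is a `C`-Gorenstein injective `R`-module: it is the image of the map
`Hom_R(C, I₀) → I⁰` in some complete `I_C I`-resolution. -/
def CGorensteinInjective (R : Type u) [CommRing R] (C : Type u) [AddCommGroup C] [Module R C]
    (G : Type u) [AddCommGroup G] [Module R G] : Prop :=
  ∃ X : CompleteICIRes R C, Nonempty (G ≃ₗ[R] LinearMap.range (X.d (-1)))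

/-- `M` has a `C`-Gorenstein injective coresolution `0 → M → G⁰ → ⋯ → Gⁿ → 0`,
i.e. `C`-Gorenstein injective dimension at most `n`. -/
def CGidLE (R : Type u) [CommRing R] (C : Type u) [AddCommGroup C] [Module R C] :
    ℕ → ModuleCat.{u} R → Prop
  | 0, M => CGorensteinInjective R C M
  | n + 1, M => ∃ (G : ModuleCat.{u} R), CGorensteinInjective R C G ∧
      ∃ ι : M →ₗ[R] G, Function.Injective ι ∧
        CGidLE R C n (ModuleCat.of R (G ⧸ LinearMap.range ι))

/-- The `C`-Gorenstein injective dimension of `M` (equal to `⊤` if `M` admits no bounded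
coresolution by `C`-Gorenstein injective modules). -/
def CGid (R : Type u) [CommRing R] (C : Type u) [AddCommGroup C] [Module R C]
    (M : Type u) [AddCommGroup M] [Module R M] : ℕ∞ :=
  sInf {n : ℕ∞ | ∃ m : ℕ, (m : ℕ∞) = n ∧ CGidLE R C m (ModuleCat.of R M)}

/-- There exists an exact sequence `0 → N → Gₙ → ⋯ → G₁ → M → 0` in which each `Gᵢ` is
`C`-Gorenstein injective (and `N` is arbitrary). -/
def CGICoresApprox (R : Type u) [CommRing R] (C : Type u) [AddCommGroup C] [Module R C] :
    ℕ → ModuleCat.{u} R → Prop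
  | 0, _ => True
  | n + 1, M => ∃ (G : ModuleCat.{u} R), CGorensteinInjective R C G ∧
      ∃ π : G →ₗ[R] M, Function.Surjective π ∧
        CGICoresApprox R C n (ModuleCat.of R (LinearMap.ker π))

/-- The `a`-torsion submodule `Γ_a(N)` of `N`. -/
def torsionSubmodule (R : Type u) [CommRing R] (a : Ideal R) (N : Type u) [AddCommGroup N]
    [Module R N] : Submodule R N :=
  ⨆ m : ℕ, Submodule.torsionBySet R N ((a ^ m : Ideal R) : Set R)

/-- `Tor_i^R(M, N)`, as an object of `ModuleCat R`. -/
abbrev TorM (R : Type u) [CommRing R] (i : ℕ) (M N : Type u) [AddCommGroup M] [Module R M]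
    [AddCommGroup N] [Module R N] : ModuleCat.{u} R :=
  ((Tor (ModuleCat.{u} R) i).obj (ModuleCat.of R M)).obj (ModuleCat.of R N)

/-- `Ext_R^i(M, N)`, as an object of `ModuleCat R`. -/
abbrev ExtM (R : Type u) [CommRing R] (i : ℕ) (M N : Type u) [AddCommGroup M] [Module R M]
    [AddCommGroup N] [Module R N] : ModuleCat.{u} R :=
  ((Ext R (ModuleCat.{u} R) i).obj (Opposite.op (ModuleCat.of R M))).obj (ModuleCat.of R N)

/-- The small support of `M`: primes `p` such that `Tor_i^R(κ(p), M) ≠ 0` for some `i`,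
where `κ(p)` is the residue field of `R_p`. -/
def smallSupport (R : Type u) [CommRing R] (M : Type u) [AddCommGroup M] [Module R M] :
    Set (PrimeSpectrum R) :=
  {p | ∃ i : ℕ,
    Nontrivial (TorM R i (IsLocalRing.ResidueField (Localization.AtPrime p.asIdeal)) M)}

/-- `C` is a semidualizing `R`-module: finitely generated, the homothety map
`R → Hom_R(C,C)` is bijective, and `Ext_R^i(C,C) = 0` for `i ≥ 1`. -/
def IsSemidualizing (R : Type u) [CommRing R] (C : Type u) [AddCommGroup C] [Module R C] : Prop :=
  Module.Finite R C ∧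
  Function.Bijective (fun r : R => (r • LinearMap.id : C →ₗ[R] C)) ∧
  ∀ i : ℕ, 1 ≤ i → Subsingleton (ExtM R i C C)

/-- `M` has injective dimension at most `n`. -/
def InjDimLE (R : Type u) [CommRing R] : ℕ → ModuleCat.{u} R → Prop
  | 0, M => Module.Injective R M
  | n + 1, M => ∃ (I : ModuleCat.{u} R), Module.Injective R I ∧
      ∃ ι : M →ₗ[R] I, Function.Injective ι ∧
        InjDimLE R n (ModuleCat.of R (I ⧸ LinearMap.range ι))

/-- `M` has flat dimension at most `n`. -/
def FlatDimLE (R : Type u) [CommRing R] : ℕ → ModuleCat.{u} R → Prop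
  | 0, M => Module.Flat R M
  | n + 1, M => ∃ (F : ModuleCat.{u} R), Module.Flat R F ∧
      ∃ π : F →ₗ[R] M, Function.Surjective π ∧
        FlatDimLE R n (ModuleCat.of R (LinearMap.ker π))

/-- `D` is a dualizing `R`-module: semidualizing of finite injective dimension. -/
def IsDualizing (R : Type u) [CommRing R] (D : Type u) [AddCommGroup D] [Module R D] : Prop :=
  IsSemidualizing R D ∧ ∃ n : ℕ, InjDimLE R n (ModuleCat.of R D)

/-- The depth of a local ring: the supremum of lengths of regular sequences contained in
the maximal ideal. -/
def localRingDepth (A : Type u) [CommRing A] [IsLocalRing A] : ℕ∞ :=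
  sSup {n : ℕ∞ | ∃ rs : List A, (∀ r ∈ rs, r ∈ IsLocalRing.maximalIdeal A) ∧
    RingTheory.Sequence.IsRegular A rs ∧ (rs.length : ℕ∞) = n}

/-- `R` is a Cohen-Macaulay ring: for each prime `p`, `depth (R_p) = dim (R_p)`. -/
def IsCohenMacaulayRing (R : Type u) [CommRing R] : Prop :=
  ∀ (p : Ideal R) (_ : p.IsPrime),
    (localRingDepth (Localization.AtPrime p) : WithBot ℕ∞) =
      ringKrullDim (Localization.AtPrime p)

/-- Serre's condition `(S₁)`: `depth (R_p) ≥ min (ht p, 1)` for every prime `p`. -/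
def SerreS1 (R : Type u) [CommRing R] : Prop :=
  ∀ (p : Ideal R) (hp : p.IsPrime),
    min (Order.height (⟨p, hp⟩ : PrimeSpectrum R)) 1 ≤ localRingDepth (Localization.AtPrime p)

/-- A Gorenstein local ring: a noetherian local ring of finite self-injective dimension. -/
def IsGorensteinLocalRing (A : Type u) [CommRing A] : Prop :=
  IsLocalRing A ∧ IsNoetherianRing A ∧ ∃ n : ℕ, InjDimLE A n (ModuleCat.of A A)

/-- A minimal injective resolution `0 → D → J⁰ → J¹ → ⋯` of `D`: an exact sequence with all
`Jⁱ` injective, in which the kernel of each differential is an essential submodule. -/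
structure MinimalInjRes (R : Type u) [CommRing R] (D : Type u) [AddCommGroup D]
    [Module R D] where
  J : ℕ → Type u
  [acg : ∀ i, AddCommGroup (J i)]
  [mod : ∀ i, Module R (J i)]
  ε : D →ₗ[R] J 0
  d : ∀ i, J i →ₗ[R] J (i + 1)
  inj : ∀ i, Module.Injective R (J i)
  ε_inj : Function.Injective ε
  exct0 : LinearMap.range ε = LinearMap.ker (d 0)
  exct : ∀ i, LinearMap.range (d i) = LinearMap.ker (d (i + 1))
  minimal : ∀ i, ∀ K : Submodule R (J i), K ≠ ⊥ → K ⊓ LinearMap.ker (d i) ≠ ⊥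

attribute [instance] MinimalInjRes.acg MinimalInjRes.mod

end

/-- A homological `A`-linear `δ`-functor on `A`-modules, concentrated in nonnegative degrees, all of
whose classes come from finitely generated submodules. -/
structure DeltaFunctor (A : Type u) [CommRing A] where
  obj : ℕ → ModuleCat.{u} A → ModuleCat.{u} A
  mapL : ∀ (i : ℕ) {M N : ModuleCat.{u} A}, (M →ₗ[A] N) →ₗ[A] (obj i M →ₗ[A] obj i N)
  mapL_id : ∀ (i : ℕ) (M : ModuleCat.{u} A),
    mapL i (LinearMap.id : M →ₗ[A] M) = LinearMap.id
  mapL_comp : ∀ (i : ℕ) {M N P : ModuleCat.{u} A} (f : M →ₗ[A] N) (g : N →ₗ[A] P),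
    mapL i (g ∘ₗ f) = mapL i g ∘ₗ mapL i f
  exact_mapL : ∀ (i : ℕ) {M N P : ModuleCat.{u} A} (f : M →ₗ[A] N) (g : N →ₗ[A] P),
    Function.Injective f → Function.Exact f g → Function.Surjective g →
    Function.Exact (mapL i f) (mapL i g)
  exists_δ : ∀ (i : ℕ) {M N P : ModuleCat.{u} A} (f : M →ₗ[A] N) (g : N →ₗ[A] P),
    Function.Injective f → Function.Exact f g → Function.Surjective g →
    ∃ δ : obj (i + 1) P →ₗ[A] obj i M,
      Function.Exact (mapL (i + 1) g) δ ∧ Function.Exact δ (mapL i f)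
  surjective_mapL_zero : ∀ {M N P : ModuleCat.{u} A} (f : M →ₗ[A] N) (g : N →ₗ[A] P),
    Function.Injective f → Function.Exact f g → Function.Surjective g →
    Function.Surjective (mapL 0 g)
  exists_fg : ∀ (i : ℕ) (M : ModuleCat.{u} A) (z : obj i M),
    ∃ K : Submodule A M, K.FG ∧ z ∈ LinearMap.range (mapL i (M := ModuleCat.of A K) K.subtype)

namespace DeltaFunctor

variable {A : Type u} [CommRing A] (h : DeltaFunctor A)

section

variable (i : ℕ) {M N P : Type u} [AddCommGroup M] [Module A M] [AddCommGroup N] [Module A N]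
  [AddCommGroup P] [Module A P]

/-- The value in degree `i` of a `δ`-functor on a module. -/
abbrev H (M : Type u) [AddCommGroup M] [Module A M] : Type u := h.obj i (ModuleCat.of A M)

/-- The action of a `δ`-functor on linear maps. -/
def map : (M →ₗ[A] N) →ₗ[A] (h.H i M →ₗ[A] h.H i N) :=
  h.mapL i (M := ModuleCat.of A M) (N := ModuleCat.of A N)

lemma map_id : h.map i (LinearMap.id : M →ₗ[A] M) = LinearMap.id := h.mapL_id i _

lemma map_comp (f : M →ₗ[A] N) (g : N →ₗ[A] P) : h.map i (g ∘ₗ f) = h.map i g ∘ₗ h.map i f :=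
  h.mapL_comp i (M := ModuleCat.of A M) (N := ModuleCat.of A N) (P := ModuleCat.of A P) f g

lemma map_comp_apply (f : M →ₗ[A] N) (g : N →ₗ[A] P) (z : h.H i M) :
    h.map i (g ∘ₗ f) z = h.map i g (h.map i f z) := by
  rw [map_comp]; rfl

lemma map_smul_id (a : A) (z : h.H i M) :
    h.map i (a • (LinearMap.id : M →ₗ[A] M)) z = a • z := by
  rw [map_smul, map_id]; rfl

/-- Linear equivalences induce linear equivalences. -/
def mapEquiv (e : M ≃ₗ[A] N) : h.H i M ≃ₗ[A] h.H i N :=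
  LinearEquiv.ofLinearMap (h.map i e.toLinearMap) (h.map i e.symm.toLinearMap)
    (by rw [← map_comp]; simp [map_id]) (by rw [← map_comp]; simp [map_id])

variable {f : M →ₗ[A] N} {g : N →ₗ[A] P} (hf : Function.Injective f) (hfg : Function.Exact f g)
  (hg : Function.Surjective g)

include hf hfg hg

lemma exact_map : Function.Exact (h.map i f) (h.map i g) :=
  h.exact_mapL i (M := ModuleCat.of A M) (N := ModuleCat.of A N) (P := ModuleCat.of A P)
    f g hf hfg hg

lemma exists_connecting : ∃ δ : h.H (i + 1) P →ₗ[A] h.H i M,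
    Function.Exact (h.map (i + 1) g) δ ∧ Function.Exact δ (h.map i f) :=
  h.exists_δ i (M := ModuleCat.of A M) (N := ModuleCat.of A N) (P := ModuleCat.of A P)
    f g hf hfg hg

lemma surjective_map_zero : Function.Surjective (h.map 0 g) :=
  h.surjective_mapL_zero (M := ModuleCat.of A M) (N := ModuleCat.of A N) (P := ModuleCat.of A P)
    f g hf hfg hg

variable {i}

lemma subsingleton_mid (h₁ : Subsingleton (h.H i M)) (h₃ : Subsingleton (h.H i P)) :
    Subsingleton (h.H i N) := by
  refine subsingleton_of_forall_eq 0 fun z ↦ ?_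
  obtain ⟨y, rfl⟩ := (h.exact_map i hf hfg hg z).1 (Subsingleton.elim _ _)
  rw [Subsingleton.elim y 0, map_zero]

lemma subsingleton_right (h₂ : Subsingleton (h.H (i + 1) N)) (h₁ : Subsingleton (h.H i M)) :
    Subsingleton (h.H (i + 1) P) := by
  obtain ⟨δ, e₁, -⟩ := h.exists_connecting i hf hfg hg
  refine subsingleton_of_forall_eq 0 fun z ↦ ?_
  obtain ⟨y, rfl⟩ := (e₁ z).1 (Subsingleton.elim _ _)
  rw [Subsingleton.elim y 0, map_zero]

lemma subsingleton_right_zero (h₂ : Subsingleton (h.H 0 N)) : Subsingleton (h.H 0 P) :=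
  (h.surjective_map_zero hf hfg hg).subsingleton

lemma subsingleton_left (h₂ : Subsingleton (h.H i N)) (h₃ : Subsingleton (h.H (i + 1) P)) :
    Subsingleton (h.H i M) := by
  obtain ⟨δ, -, e₂⟩ := h.exists_connecting i hf hfg hg
  refine subsingleton_of_forall_eq 0 fun z ↦ ?_
  obtain ⟨y, rfl⟩ := (e₂ z).1 (Subsingleton.elim _ _)
  rw [Subsingleton.elim y 0, map_zero]

lemma injective_map (h₃ : Subsingleton (h.H (i + 1) P)) : Function.Injective (h.map i f) := by
  obtain ⟨δ, -, e₂⟩ := h.exists_connecting i hf hfg hg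
  refine (injective_iff_map_eq_zero _).2 fun z hz ↦ ?_
  obtain ⟨y, rfl⟩ := (e₂ z).1 hz
  rw [Subsingleton.elim y 0, map_zero]

lemma surjective_map (h₁ : ∀ j, i = j + 1 → Subsingleton (h.H j M)) :
    Function.Surjective (h.map i g) := by
  cases i with
  | zero => exact h.surjective_map_zero hf hfg hg
  | succ j =>
    obtain ⟨δ, e₁, -⟩ := h.exists_connecting j hf hfg hg
    have := h₁ j rfl
    exact fun z ↦ (e₁ z).1 (Subsingleton.elim _ _)

end

end DeltaFunctor

section Coregular

variable {A : Type u} [CommRing A]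

/-- The submodule of elements killed by each member of a list, constructed one member at a time. -/
def iterTorsion : List A → ModuleCat.{u} A → ModuleCat.{u} A
  | [], M => M
  | x :: xs, M => iterTorsion xs (ModuleCat.of A (Submodule.torsionBy A M x))

/-- A sequence is coregular on `M` if each member acts surjectively on the elements of `M` killed by
the previous members. -/
def IsCoregular : List A → ModuleCat.{u} A → Prop
  | [], _ => True
  | x :: xs, M => (∀ m : M, ∃ m' : M, x • m' = m) ∧
      IsCoregular xs (ModuleCat.of A (Submodule.torsionBy A M x))

/-- A linear equivalence restricts to torsion submodules. -/
def torsionByEquiv {M N : Type*} [AddCommGroup M] [Module A M] [AddCommGroup N] [Module A N]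
    (e : M ≃ₗ[A] N) (x : A) : Submodule.torsionBy A M x ≃ₗ[A] Submodule.torsionBy A N x :=
  e.ofSubmodules _ _ (by
    ext n
    simp only [Submodule.mem_map, Submodule.mem_torsionBy_iff]
    constructor
    · rintro ⟨m, hm, rfl⟩
      simp [← map_smul, hm]
    · intro hn
      exact ⟨e.symm n, by rw [← map_smul, hn, map_zero], by simp⟩)

lemma IsCoregular.congr {xs : List A} {M N : ModuleCat.{u} A} (hM : IsCoregular xs M)
    (e : M ≃ₗ[A] N) : IsCoregular xs N := by
  induction xs generalizing M N with
  | nil => trivial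
  | cons x xs ih =>
    refine ⟨fun n ↦ ?_, ih (M := ModuleCat.of A (Submodule.torsionBy A M x))
      (N := ModuleCat.of A (Submodule.torsionBy A N x)) hM.2 (torsionByEquiv e x)⟩
    obtain ⟨m, hm⟩ := hM.1 (e.symm n)
    exact ⟨e m, by rw [← map_smul, hm]; simp⟩

lemma mem_annihilator_iterTorsion (xs : List A) (M : ModuleCat.{u} A) (a : A)
    (ha : ∀ m : M, a • m = 0) (t : iterTorsion xs M) : a • t = 0 := by
  induction xs generalizing M with
  | nil => exact ha t
  | cons x xs ih =>
    exact ih (ModuleCat.of A (Submodule.torsionBy A M x)) (fun m ↦ Subtype.ext (ha m)) t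

lemma ofList_smul_iterTorsion (xs : List A) (M : ModuleCat.{u} A) (a : A)
    (ha : a ∈ Ideal.ofList xs) (t : iterTorsion xs M) : a • t = 0 := by
  suffices Ideal.ofList xs ≤ Module.annihilator A (iterTorsion xs M) from
    Module.mem_annihilator.1 (this ha) t
  rw [Ideal.ofList, Ideal.span_le]
  clear ha t a
  induction xs generalizing M with
  | nil => simp
  | cons x xs ih =>
    intro a ha
    rcases List.mem_cons.1 ha with rfl | ha
    · exact Module.mem_annihilator.2 (mem_annihilator_iterTorsion xs
        (ModuleCat.of A (Submodule.torsionBy A M a)) a (fun m ↦ Subtype.ext m.2))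
    · exact ih _ ha

/-- Every element is killed by a power of `x`. -/
def IsPowTorsion (x : A) (M : Type*) [AddCommGroup M] [Module A M] : Prop :=
  ∀ m : M, ∃ n : ℕ, x ^ n • m = 0

lemma IsPowTorsion.submodule {x : A} {M : Type*} [AddCommGroup M] [Module A M]
    (hM : IsPowTorsion x M) (K : Submodule A M) : IsPowTorsion x K := fun m ↦
  (hM m).imp fun _ hn ↦ Subtype.ext hn

lemma IsPowTorsion.subsingleton {x : A} {M : Type*} [AddCommGroup M] [Module A M]
    (hM : IsPowTorsion x M) (h : ∀ m : M, x • m = 0 → m = 0) : Subsingleton M := by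
  refine subsingleton_of_forall_eq 0 fun m ↦ ?_
  obtain ⟨n, hn⟩ := hM m
  induction n with
  | zero => simpa using hn
  | succ n ih => exact ih (h _ (by rwa [smul_smul, ← pow_succ']))

lemma subsingleton_of_iterTorsion (xs : List A) (M : ModuleCat.{u} A)
    (hM : ∀ x ∈ xs, IsPowTorsion x M) (h : Subsingleton (iterTorsion xs M)) : Subsingleton M := by
  induction xs generalizing M with
  | nil => exact h
  | cons x xs ih =>
    have := ih (ModuleCat.of A (Submodule.torsionBy A M x))
      (fun y hy ↦ (hM y (List.mem_cons_of_mem _ hy)).submodule _) h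
    refine (hM x List.mem_cons_self).subsingleton fun m hm ↦ ?_
    exact congrArg Subtype.val (Subsingleton.elim (⟨m, hm⟩ : Submodule.torsionBy A M x) 0)

end Coregular

namespace DeltaFunctor

variable {A : Type u} [CommRing A] (h : DeltaFunctor A)

section Regular

open scoped Pointwise

variable {M : Type u} [AddCommGroup M] [Module A M] {x : A} (hx : IsSMulRegular M x)

include hx

lemma injective_lsmul : Function.Injective (x • (LinearMap.id : M →ₗ[A] M)) := hx

omit hx in
lemma exact_lsmul_mkQ (M : Type u) [AddCommGroup M] [Module A M] (x : A) :
    Function.Exact (x • (LinearMap.id : M →ₗ[A] M))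
      (Submodule.mkQ (x • (⊤ : Submodule A M))) := by
  intro m
  rw [Submodule.mkQ_apply, Submodule.Quotient.mk_eq_zero, Submodule.mem_smul_pointwise_iff_exists]
  simp

lemma quotSMulTop_subsingleton_and_equiv (e : ℕ) (hM : ∀ i, i ≠ e → Subsingleton (h.H i M))
    (hdiv : ∀ z : h.H e M, ∃ y, x • y = z) :
    (∀ i, i ≠ e + 1 → Subsingleton (h.H i (QuotSMulTop x M))) ∧
    Nonempty (h.H (e + 1) (QuotSMulTop x M) ≃ₗ[A] Submodule.torsionBy A (h.H e M) x) := by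
  have hinj := injective_lsmul hx
  have hex := exact_lsmul_mkQ M x
  have hsurj := Submodule.mkQ_surjective (x • (⊤ : Submodule A M))
  have hdiv' : ∀ i, ∀ z : h.H i M, ∃ y, h.map i (x • LinearMap.id) y = z := fun i z ↦ by
    by_cases hi : i = e
    · subst hi
      obtain ⟨y, hy⟩ := hdiv z
      exact ⟨y, by rw [map_smul_id, hy]⟩
    · have := hM i hi
      exact ⟨0, Subsingleton.elim _ _⟩
  have hzero : ∀ i (z : h.H i M), h.map i (Submodule.mkQ (x • (⊤ : Submodule A M))) z = 0 := by
    intro i z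
    obtain ⟨y, rfl⟩ := hdiv' i z
    exact (h.exact_map i hinj hex hsurj _).2 ⟨y, rfl⟩
  have key : ∀ i, ∃ δ : h.H (i + 1) (QuotSMulTop x M) →ₗ[A] h.H i M, Function.Injective δ ∧
      ∀ z, x • z = 0 ↔ z ∈ Set.range δ := by
    intro i
    obtain ⟨δ, e₁, e₂⟩ := h.exists_connecting i hinj hex hsurj
    refine ⟨δ, (injective_iff_map_eq_zero _).2 fun z hz ↦ ?_, fun z ↦ ?_⟩
    · obtain ⟨y, rfl⟩ := (e₁ z).1 hz
      exact hzero _ y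
    · rw [← map_smul_id]
      exact e₂ z
  refine ⟨fun i hi ↦ ?_, ?_⟩
  · cases i with
    | zero =>
      refine subsingleton_of_forall_eq 0 fun z ↦ ?_
      obtain ⟨y, rfl⟩ := h.surjective_map_zero hinj hex hsurj z
      exact hzero _ y
    | succ i =>
      obtain ⟨δ, h₁, -⟩ := key i
      have := hM i (by omega)
      exact h₁.subsingleton
  · obtain ⟨δ, h₁, h₂⟩ := key e
    refine ⟨LinearEquiv.ofBijective
      (δ.codRestrict (Submodule.torsionBy A (h.H e M) x) fun z ↦ (h₂ _).2 ⟨z, rfl⟩) ⟨?_, ?_⟩⟩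
    · exact fun a b hab ↦ h₁ (congrArg Subtype.val hab)
    · rintro ⟨z, hz⟩
      obtain ⟨y, hy⟩ := (h₂ z).1 hz
      exact ⟨y, Subtype.ext hy⟩

end Regular

/-- If the `δ`-functor takes `M` to a module `N` concentrated in degree `e` on which an `M`-regular
sequence is coregular, then it takes the quotient of `M` by the sequence to the iterated torsion of
`N`, shifted by the length of the sequence. -/
lemma quot_ofList_subsingleton_and_equiv (xs : List A) {M : Type u} [AddCommGroup M] [Module A M]
    (hxs : RingTheory.Sequence.IsWeaklyRegular M xs) (e : ℕ)
    (hM : ∀ i, i ≠ e → Subsingleton (h.H i M)) {N : ModuleCat.{u} A} (f : h.H e M ≃ₗ[A] N)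
    (hN : IsCoregular xs N) :
    (∀ i, i ≠ e + xs.length →
      Subsingleton (h.H i (M ⧸ (Ideal.ofList xs • ⊤ : Submodule A M)))) ∧
    Nonempty (h.H (e + xs.length) (M ⧸ (Ideal.ofList xs • ⊤ : Submodule A M)) ≃ₗ[A]
      iterTorsion xs N) := by
  induction xs generalizing M N e with
  | nil =>
    have g : (M ⧸ (Ideal.ofList ([] : List A) • ⊤ : Submodule A M)) ≃ₗ[A] M :=
      Submodule.quotEquivOfEqBot _ (by simp)
    exact ⟨fun i hi ↦ (h.mapEquiv i g).toEquiv.subsingleton_congr.2 (hM i (by simpa using hi)),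
      ⟨(h.mapEquiv e g).trans f⟩⟩
  | cons x xs ih =>
    rw [RingTheory.Sequence.isWeaklyRegular_cons_iff] at hxs
    obtain ⟨h₁, ⟨k⟩⟩ := h.quotSMulTop_subsingleton_and_equiv hxs.1 e hM (fun z ↦ by
      obtain ⟨y, hy⟩ := hN.1 (f z)
      exact ⟨f.symm y, f.injective (by simp [hy])⟩)
    obtain ⟨h₂, ⟨l⟩⟩ := ih hxs.2 (e + 1) h₁
      (N := ModuleCat.of A (Submodule.torsionBy A N x)) (k.trans (torsionByEquiv f x)) hN.2
    have g := Submodule.quotOfListConsSMulTopEquivQuotSMulTopInner M x xs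
    have hl : e + (x :: xs).length = e + 1 + xs.length := by simp; omega
    rw [hl]
    exact ⟨fun i hi ↦ (h.mapEquiv i g).toEquiv.subsingleton_congr.2 (h₂ i hi),
      ⟨(h.mapEquiv _ g).trans l⟩⟩

section Torsion

variable {x : A} {T : Type u} [AddCommGroup T] [Module A T]

lemma isPowTorsion (hT : IsPowTorsion x T) (i : ℕ) : IsPowTorsion x (h.H i T) := by
  intro z
  obtain ⟨K, hK, ⟨y, rfl⟩⟩ := h.exists_fg i (ModuleCat.of A T) z
  obtain ⟨s, hs⟩ := hK
  choose n hn using fun m : T ↦ hT m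
  have hkill : ∀ m ∈ K, x ^ (s.sum n) • m = 0 := by
    intro m hm
    have : K ≤ Submodule.torsionBy A T (x ^ (s.sum n)) := by
      rw [← hs, Submodule.span_le]
      intro m hm
      rw [SetLike.mem_coe, Submodule.mem_torsionBy_iff,
        ← Nat.sub_add_cancel (Finset.single_le_sum (fun _ _ ↦ Nat.zero_le _) hm : n m ≤ s.sum n),
        pow_add, mul_smul, hn, smul_zero]
    exact this hm
  refine ⟨s.sum n, ?_⟩
  have h0 : x ^ (s.sum n) • (LinearMap.id : K →ₗ[A] K) = 0 := by
    ext m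
    exact hkill m m.2
  have : x ^ (s.sum n) • y = 0 := by
    rw [← h.map_smul_id i (M := K), h0, map_zero, LinearMap.zero_apply]
  rw [← map_smul]
  exact (congrArg _ this).trans (map_zero _)

variable (hdiv : ∀ t : T, ∃ t', x • t' = t)

lemma exact_subtype_lsmul (T : Type u) [AddCommGroup T] [Module A T] (x : A) :
    Function.Exact (Submodule.torsionBy A T x).subtype (x • (LinearMap.id : T →ₗ[A] T)) := by
  intro t
  simp

include hdiv

lemma subsingleton_of_torsionBy (hT : IsPowTorsion x T) (i : ℕ)
    (hi : Subsingleton (h.H i (Submodule.torsionBy A T x))) : Subsingleton (h.H i T) := by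
  refine (h.isPowTorsion hT i).subsingleton fun z hz ↦ ?_
  rw [← map_smul_id] at hz
  obtain ⟨y, rfl⟩ :=
    (h.exact_map i (Submodule.subtype_injective _) (exact_subtype_lsmul T x) hdiv z).1 hz
  rw [Subsingleton.elim y 0, map_zero]

lemma subsingleton_torsionBy (i : ℕ) (h₁ : Subsingleton (h.H (i + 1) T))
    (h₂ : Subsingleton (h.H i T)) : Subsingleton (h.H i (Submodule.torsionBy A T x)) :=
  h.subsingleton_left (Submodule.subtype_injective _) (exact_subtype_lsmul T x) hdiv h₂ h₁

end Torsion

lemma subsingleton_of_iterTorsion (xs : List A) (T : ModuleCat.{u} A) (hT : IsCoregular xs T)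
    (htors : ∀ x ∈ xs, IsPowTorsion x T) (i : ℕ)
    (hi : Subsingleton (h.obj i (iterTorsion xs T))) : Subsingleton (h.obj i T) := by
  induction xs generalizing T with
  | nil => exact hi
  | cons x xs ih =>
    exact h.subsingleton_of_torsionBy hT.1 (htors x List.mem_cons_self) i
      (ih (ModuleCat.of A (Submodule.torsionBy A T x)) hT.2
        (fun y hy ↦ (htors y (List.mem_cons_of_mem _ hy)).submodule _) hi)

lemma subsingleton_iterTorsion (xs : List A) (T : ModuleCat.{u} A) (hT : IsCoregular xs T)
    (htors : ∀ x ∈ xs, IsPowTorsion x T) (i : ℕ)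
    (hi : Subsingleton (h.obj (i + 1) (iterTorsion xs T))) (h₀ : Subsingleton (h.obj i T)) :
    Subsingleton (h.obj i (iterTorsion xs T)) := by
  induction xs generalizing T with
  | nil => exact h₀
  | cons x xs ih =>
    exact ih (ModuleCat.of A (Submodule.torsionBy A T x)) hT.2
      (fun y hy ↦ (htors y (List.mem_cons_of_mem _ hy)).submodule _) hi
      (h.subsingleton_torsionBy hT.1 i
        (h.subsingleton_of_iterTorsion (x :: xs) T hT htors _ hi) h₀)

end DeltaFunctor

lemma Ideal.exists_surjective_pi_quotient {A : Type*} [CommRing A] (I : Ideal A) (M : Type*)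
    [AddCommGroup M] [Module A M] [Module.Finite A M] (hM : ∀ a ∈ I, ∀ m : M, a • m = 0) :
    ∃ (n : ℕ) (g : (Fin n → A ⧸ I) →ₗ[A] M), Function.Surjective g := by
  obtain ⟨n, f, hf⟩ := Module.Finite.exists_fin' A M
  let g : (Fin n → A ⧸ I) →ₗ[A] M :=
    LinearMap.lsum A (fun _ ↦ A ⧸ I) A fun j ↦
      I.liftQ (f ∘ₗ LinearMap.single A (fun _ ↦ A) j) fun a ha ↦ by
        rw [LinearMap.mem_ker]
        have := hM a ha (f (Pi.single j 1))
        rw [← map_smul] at this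
        rw [LinearMap.comp_apply, LinearMap.single_apply, ← this]
        congr 1
        ext k
        by_cases hk : k = j
        · subst hk; simp
        · simp [hk]
  refine ⟨n, g, fun m ↦ ?_⟩
  obtain ⟨v, rfl⟩ := hf m
  refine ⟨fun j ↦ Ideal.Quotient.mk I (v j), ?_⟩
  simp only [g, LinearMap.lsum_apply, LinearMap.sum_apply, LinearMap.comp_apply,
    LinearMap.proj_apply]
  conv_rhs => rw [← Finset.univ_sum_single v, map_sum]
  exact Finset.sum_congr rfl fun j _ ↦ rfl

lemma Ideal.smul_pi_quotient {A ι : Type*} [CommRing A] (I : Ideal A) {a : A} (ha : a ∈ I)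
    (v : ι → A ⧸ I) : a • v = 0 := by
  ext j
  obtain ⟨b, hb⟩ := Ideal.Quotient.mk_surjective (v j)
  rw [Pi.smul_apply, ← hb]
  exact Ideal.Quotient.eq_zero_iff_mem.2 (I.mul_mem_right b ha)

namespace DeltaFunctor

variable {A : Type u} [CommRing A] (h : DeltaFunctor A)

lemma sum_map_single_proj (i : ℕ) {n : ℕ} {M : Type u} [AddCommGroup M] [Module A M]
    (z : h.H i (Fin n → M)) :
    ∑ j, h.map i (LinearMap.single A (fun _ : Fin n ↦ M) j)
      (h.map i (LinearMap.proj (φ := fun _ : Fin n ↦ M) j) z) = z := by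
  simp_rw [← map_comp_apply, ← LinearMap.sum_apply, ← map_sum]
  have : ∑ j, (LinearMap.single A (fun _ : Fin n ↦ M) j) ∘ₗ
      (LinearMap.proj (φ := fun _ : Fin n ↦ M) j) = LinearMap.id := by
    ext; simp
  rw [this, map_id, LinearMap.id_apply]

lemma subsingleton_pi (i n : ℕ) {M : Type u} [AddCommGroup M] [Module A M]
    (hM : Subsingleton (h.H i M)) : Subsingleton (h.H i (Fin n → M)) := by
  refine subsingleton_of_forall_eq 0 fun z ↦ ?_
  rw [← h.sum_map_single_proj i z]
  refine Finset.sum_eq_zero fun j _ ↦ ?_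
  rw [Subsingleton.elim (h.map i (LinearMap.proj (φ := fun _ : Fin n ↦ M) j) z) 0, map_zero]

lemma subsingleton_finsupp (i : ℕ) (ι : Type u) {M : Type u} [AddCommGroup M] [Module A M]
    (hM : Subsingleton (h.H i M)) : Subsingleton (h.H i (ι →₀ M)) := by
  classical
  refine subsingleton_of_forall_eq 0 fun z ↦ ?_
  obtain ⟨K, ⟨s, hs⟩, ⟨y, rfl⟩⟩ := h.exists_fg i (ModuleCat.of A (ι →₀ M)) z
  let S : Finset ι := s.biUnion Finsupp.support
  have hS : ∀ m ∈ K, m.support ⊆ S := by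
    intro m hm
    have : K ≤ Finsupp.supported M A (S : Set ι) := by
      rw [← hs, Submodule.span_le]
      intro m hm
      rw [SetLike.mem_coe, Finsupp.mem_supported, Finset.coe_subset]
      exact Finset.subset_biUnion_of_mem Finsupp.support hm
    exact_mod_cast (Finsupp.mem_supported A m).1 (this hm)
  have hsum : K.subtype = ∑ j ∈ S, Finsupp.lsingle j ∘ₗ Finsupp.lapply j ∘ₗ K.subtype := by
    ext m k
    simp only [LinearMap.sum_apply, LinearMap.comp_apply, Finsupp.lsingle_apply,
      Finsupp.lapply_apply, Finsupp.finsetSum_apply, Submodule.subtype_apply]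
    by_cases hk : k ∈ S
    · rw [Finset.sum_eq_single_of_mem k hk (fun b _ hb ↦ Finsupp.single_eq_of_ne' hb)]
      simp
    · rw [Finset.sum_eq_zero fun b hb ↦ Finsupp.single_eq_of_ne' (by rintro rfl; exact hk hb)]
      exact Finsupp.notMem_support_iff.1 fun hk' ↦ hk (hS _ m.2 hk')
  change h.map i K.subtype y = 0
  rw [hsum, map_sum, LinearMap.sum_apply]
  refine Finset.sum_eq_zero fun j _ ↦ ?_
  rw [map_comp_apply, Subsingleton.elim (h.map i _ y) 0, map_zero]

lemma subsingleton_of_finsupp (i : ℕ) (ι : Type u) [Nonempty ι] {M : Type u} [AddCommGroup M]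
    [Module A M] (hM : Subsingleton (h.H i (ι →₀ M))) : Subsingleton (h.H i M) := by
  obtain ⟨j⟩ := ‹Nonempty ι›
  refine subsingleton_of_forall_eq 0 fun z ↦ ?_
  have : (Finsupp.lapply j ∘ₗ Finsupp.lsingle j : M →ₗ[A] M) = LinearMap.id := by
    ext; simp
  rw [← LinearMap.id_apply (R := A) z, ← map_id, ← this, map_comp_apply,
    Subsingleton.elim (h.map i _ z) 0, map_zero]

section Local

variable [IsLocalRing A]

lemma subsingleton_of_isFiniteLength (i : ℕ)
    (hκ : Subsingleton (h.H i (A ⧸ IsLocalRing.maximalIdeal A)))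
    {M : Type u} [AddCommGroup M] [Module A M] (hM : IsFiniteLength A M) :
    Subsingleton (h.H i M) := by
  induction hM with
  | @of_subsingleton M _ _ _ =>
    refine subsingleton_of_forall_eq 0 fun z ↦ ?_
    rw [← LinearMap.id_apply (R := A) z, ← map_id,
      Subsingleton.elim (LinearMap.id : M →ₗ[A] M) 0, map_zero, LinearMap.zero_apply]
  | @of_simple_quotient M _ _ N hs _ ih =>
    refine h.subsingleton_mid N.subtype_injective (LinearMap.exact_subtype_mkQ N)
      N.mkQ_surjective ih ?_
    obtain ⟨I, hI, ⟨e⟩⟩ := isSimpleModule_iff_quot_maximal.1 hs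
    obtain rfl := IsLocalRing.eq_maximalIdeal hI
    exact (h.mapEquiv i e).toEquiv.subsingleton_congr.2 hκ

lemma exists_injective_of_isFiniteLength {M : Type*} [AddCommGroup M] [Module A M] [Nontrivial M]
    (hM : IsFiniteLength A M) :
    ∃ f : (A ⧸ IsLocalRing.maximalIdeal A) →ₗ[A] M, Function.Injective f := by
  obtain ⟨_, _⟩ := isFiniteLength_iff_isNoetherian_isArtinian.1 hM
  obtain ⟨N, hN⟩ := IsAtomic.exists_atom (Submodule A M)
  rw [← isSimpleModule_iff_isAtom] at hN
  obtain ⟨I, hI, ⟨e⟩⟩ := isSimpleModule_iff_quot_maximal.1 hN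
  obtain rfl := IsLocalRing.eq_maximalIdeal hI
  exact ⟨N.subtype ∘ₗ e.symm.toLinearMap, N.subtype_injective.comp e.symm.injective⟩

/-- If a bounded `δ`-functor vanishes above degree `d` on a module of finite length, then it
vanishes above degree `d` on all modules of finite length. -/
lemma subsingleton_of_isFiniteLength_of_lt {B : Type u} [AddCommGroup B] [Module A B] [Nontrivial B]
    (hB : IsFiniteLength A B) (n d : ℕ)
    (hn : ∀ i, n < i → Subsingleton (h.H i (A ⧸ IsLocalRing.maximalIdeal A)))
    (hd : ∀ i, d < i → Subsingleton (h.H i B)) (i : ℕ) (hi : d < i)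
    {M : Type u} [AddCommGroup M] [Module A M] (hM : IsFiniteLength A M) :
    Subsingleton (h.H i M) := by
  refine h.subsingleton_of_isFiniteLength i ?_ hM
  suffices ∀ k i, n < i + k → d < i →
      Subsingleton (h.H i (A ⧸ IsLocalRing.maximalIdeal A)) from this (n + 1) i (by omega) hi
  intro k
  induction k with
  | zero => exact fun i hi _ ↦ hn i hi
  | succ k ih =>
    intro i hi hdi
    obtain ⟨f, hf⟩ := exists_injective_of_isFiniteLength hB
    refine h.subsingleton_left (N := B) hf (LinearMap.exact_map_mkQ_range f)
      (Submodule.mkQ_surjective _) (hd i hdi) ?_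
    exact h.subsingleton_of_isFiniteLength _ (ih (i + 1) (by omega) (by omega))
      (hB.of_surjective (Submodule.mkQ_surjective _))

end Local

section Noetherian

variable [IsNoetherianRing A] (I : Ideal A)

/-- If a `δ`-functor vanishes on `A ⧸ I` in degrees less than `k`, it vanishes there on all finite
modules killed by `I`. -/
lemma subsingleton_of_lt (k : ℕ) (hI : ∀ i < k, Subsingleton (h.H i (A ⧸ I))) (i : ℕ) (hi : i < k)
    (M : Type u) [AddCommGroup M] [Module A M] [Module.Finite A M]
    (hM : ∀ a ∈ I, ∀ m : M, a • m = 0) : Subsingleton (h.H i M) := by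
  induction i generalizing M with
  | zero =>
    obtain ⟨n, g, hg⟩ := I.exists_surjective_pi_quotient M hM
    exact h.subsingleton_right_zero (LinearMap.ker g).subtype_injective
      (LinearMap.exact_subtype_ker_map g) hg (h.subsingleton_pi 0 n (hI 0 hi))
  | succ i ih =>
    obtain ⟨n, g, hg⟩ := I.exists_surjective_pi_quotient M hM
    refine h.subsingleton_right (LinearMap.ker g).subtype_injective
      (LinearMap.exact_subtype_ker_map g) hg (h.subsingleton_pi (i + 1) n (hI _ hi)) ?_
    exact ih (by omega) _ fun a ha m ↦ Subtype.ext (I.smul_pi_quotient ha m.1)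

/-- If the values of a `δ`-functor on finite modules killed by `I` are concentrated in degree `d`,
then its value on `A ⧸ I` is flat. -/
lemma flat_of_subsingleton (d : ℕ) (hlt : ∀ i < d, Subsingleton (h.H i (A ⧸ I)))
    (hd : ∀ (M : Type u) [AddCommGroup M] [Module A M] [Module.Finite A M],
      (∀ a ∈ I, ∀ m : M, a • m = 0) → Subsingleton (h.H (d + 1) M))
    {T : Type u} [AddCommGroup T] [Module A T] [Module (A ⧸ I) T] [IsScalarTower A (A ⧸ I) T]
    (e : h.H d (A ⧸ I) ≃ₗ[A] T) : Module.Flat (A ⧸ I) T := by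
  have hmul : ∀ (b : A ⧸ I) (z : h.H d (A ⧸ I)), e (h.map d (LinearMap.mulLeft A b) z) = b • e z := by
    intro b z
    obtain ⟨a, rfl⟩ := Ideal.Quotient.mk_surjective b
    have : LinearMap.mulLeft A (Ideal.Quotient.mk I a) = a • LinearMap.id := by
      ext; simp [Algebra.smul_def]
    rw [this, map_smul_id, map_smul]
    exact (algebraMap_smul (A ⧸ I) a (e z)).symm
  have hpi : ∀ (M : Type u) [AddCommGroup M] [Module A M] (n : ℕ) (f : M →ₗ[A] Fin n → A ⧸ I),
      Function.Injective f → ∀ a ∈ I, ∀ m : M, a • m = 0 := fun M _ _ n f hf a ha m ↦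
    hf (by rw [map_smul, map_zero, I.smul_pi_quotient ha])
  refine Module.Flat.of_forall_isTrivialRelation fun {l f x} hfx ↦ ?_
  let φ : (Fin l → A ⧸ I) →ₗ[A] A ⧸ I :=
    ∑ i, LinearMap.mulLeft A (f i) ∘ₗ LinearMap.proj (φ := fun _ ↦ A ⧸ I) i
  let t : h.H d (Fin l → A ⧸ I) :=
    ∑ i, h.map d (LinearMap.single A (fun _ : Fin l ↦ A ⧸ I) i) (e.symm (x i))
  have ht : ∀ i, h.map d (LinearMap.proj (φ := fun _ : Fin l ↦ A ⧸ I) i) t = e.symm (x i) := by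
    intro i
    simp only [t, map_sum, ← map_comp_apply]
    rw [Finset.sum_eq_single_of_mem i (Finset.mem_univ i) fun j _ hj ↦ ?_]
    · rw [LinearMap.proj_comp_single_same, map_id, LinearMap.id_apply]
    · rw [LinearMap.proj_comp_single_ne _ _ _ _ hj.symm, map_zero, LinearMap.zero_apply]
  have hφt : h.map d φ t = 0 := by
    apply e.injective
    simp only [φ, map_sum, LinearMap.sum_apply, map_comp_apply, ht, hmul, map_zero,
      LinearEquiv.apply_symm_apply, hfx]
  have hφt' : h.map d φ.rangeRestrict t = 0 := by
    refine h.injective_map (LinearMap.range φ).subtype_injective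
      (LinearMap.exact_subtype_mkQ _) (Submodule.mkQ_surjective _) (hd _ fun a ha m ↦ ?_) ?_
    · obtain ⟨m, rfl⟩ := Submodule.mkQ_surjective _ m
      obtain ⟨b, rfl⟩ := Ideal.Quotient.mk_surjective m
      rw [← map_smul]
      exact (congrArg _ (Ideal.Quotient.eq_zero_iff_mem.2 (I.mul_mem_right b ha))).trans (map_zero _)
    · rw [← map_comp_apply, map_zero]
      exact hφt
  obtain ⟨s, hs⟩ := (h.exact_map d (LinearMap.ker φ).subtype_injective
    (g := φ.rangeRestrict) (fun v ↦ by simp [← Subtype.val_inj]) φ.surjective_rangeRestrict t).1 hφt'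
  obtain ⟨k, ψ, hψ⟩ := I.exists_surjective_pi_quotient (LinearMap.ker φ)
    (hpi _ _ _ (LinearMap.ker φ).subtype_injective)
  obtain ⟨y, rfl⟩ := h.surjective_map (i := d) (LinearMap.ker ψ).subtype_injective
    (LinearMap.exact_subtype_ker_map ψ) hψ (fun j hj ↦ h.subsingleton_of_lt I d hlt j (by omega) _
      (hpi _ _ _ (LinearMap.ker ψ).subtype_injective)) s
  let a : Fin k → (Fin l → A ⧸ I) := fun j ↦ (ψ (Pi.single j 1)).1
  refine ⟨k, fun i j ↦ a j i, fun j ↦ e (h.map d (LinearMap.proj j) y), fun i ↦ ?_, fun j ↦ ?_⟩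
  · simp only [← hmul, ← map_sum, ← map_comp_apply, ← LinearMap.sum_apply]
    rw [← e.symm_apply_eq, ← ht i, ← hs, ← map_comp_apply, ← map_comp_apply]
    congr 2
    ext j
    have hsum : ∑ c, a c i * (Pi.single j 1 : Fin k → A ⧸ I) c = a j i := by
      rw [Finset.sum_eq_single_of_mem j (Finset.mem_univ j)
        (fun b _ hb ↦ by rw [Pi.single_eq_of_ne hb, mul_zero]), Pi.single_eq_same, mul_one]
    simpa using hsum.symm
  · have := (ψ (Pi.single j 1)).2
    rw [LinearMap.mem_ker] at this
    simp only [φ, LinearMap.sum_apply] at this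
    exact this

end Noetherian

end DeltaFunctor

section

open TensorProduct IsLocalRing

/-- Flat modules over a local ring with nilpotent maximal ideal are free. -/
lemma Module.Flat.nonempty_linearEquiv_finsupp (B : Type u) [CommRing B] [IsLocalRing B]
    (hB : IsNilpotent (maximalIdeal B)) (T : Type u) [AddCommGroup T] [Module B T]
    [Module.Flat B T] : ∃ ι : Type u, Nonempty (T ≃ₗ[B] (ι →₀ B)) := by
  let b := Module.Basis.ofVectorSpace (ResidueField B) (ResidueField B ⊗[B] T)
  choose v hv using fun i ↦
    TensorProduct.mk_surjective B T (ResidueField B) Ideal.Quotient.mk_surjective (b i)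
  have hli : LinearIndependent B v := IsLocalRing.linearIndependent_of_flat v (by
    have : TensorProduct.mk B (ResidueField B) T 1 ∘ v = b := funext hv
    rw [this]
    exact b.linearIndependent)
  refine ⟨_, ⟨(Module.Basis.mk hli ?_).repr⟩⟩
  set N := Submodule.span B (Set.range v)
  have hsub : Subsingleton (ResidueField B ⊗[B] (T ⧸ N)) := by
    refine subsingleton_of_forall_eq 0 fun z ↦ ?_
    obtain ⟨y, rfl⟩ := LinearMap.lTensor_surjective (ResidueField B) N.mkQ_surjective z
    have hzero : N.mkQ.baseChange (ResidueField B) = 0 := b.ext fun i ↦ by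
      rw [← hv i, TensorProduct.mk_apply, LinearMap.baseChange_tmul, Submodule.mkQ_apply,
        (Submodule.Quotient.mk_eq_zero N).2 (Submodule.subset_span ⟨i, rfl⟩), tmul_zero,
        LinearMap.zero_apply]
    exact LinearMap.congr_fun hzero y
  have htop : maximalIdeal B • (⊤ : Submodule B (T ⧸ N)) = ⊤ := by
    rw [← Submodule.Quotient.subsingleton_iff]
    exact (TensorProduct.quotTensorEquivQuotSMul (T ⧸ N)
      (maximalIdeal B)).toEquiv.subsingleton_congr.1 hsub
  obtain ⟨n, hn⟩ := hB
  have hpow : ∀ k, maximalIdeal B ^ k • (⊤ : Submodule B (T ⧸ N)) = ⊤ := by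
    intro k
    induction k with
    | zero => simp
    | succ k ih => rw [pow_succ, Submodule.mul_smul, htop, ih]
  have := hpow n
  rw [hn, zero_smul] at this
  rintro m -
  have hm : N.mkQ m ∈ (⊤ : Submodule B (T ⧸ N)) := trivial
  rw [← this] at hm
  exact (Submodule.Quotient.mk_eq_zero N).1 hm

end

namespace DeltaFunctor

open IsLocalRing

variable {A : Type u} [CommRing A] [IsLocalRing A] [IsNoetherianRing A]

/-- Let `t` and `g` be `δ`-functors such as `Tor(-, T)` and `Tor(-, G)`, the first one bounded, and
suppose that a maximal regular sequence is coregular on both `T` and `G`. Then `Tor(-, G)` vanishes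
on the residue field if and only if it vanishes on `T` in degree the length of the sequence. -/
theorem subsingleton_residueField_iff (xs : List A)
    (hxs : RingTheory.Sequence.IsWeaklyRegular A xs) (hm : ∀ x ∈ xs, x ∈ maximalIdeal A)
    (hart : IsArtinianRing (A ⧸ Ideal.ofList xs))
    (T : ModuleCat.{u} A) (hT : IsCoregular xs T) (hTtors : ∀ x ∈ xs, IsPowTorsion x T)
    (hTn : Nontrivial T) (t : DeltaFunctor A) (et : t.H 0 A ≃ₗ[A] T)
    (ht : ∀ i, i ≠ 0 → Subsingleton (t.H i A)) (n : ℕ)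
    (hn : ∀ i, n < i → Subsingleton (t.H i (A ⧸ maximalIdeal A)))
    (G : ModuleCat.{u} A) (hG : IsCoregular xs G) (g : DeltaFunctor A) (eg : g.H 0 A ≃ₗ[A] G)
    (hg : ∀ i, i ≠ 0 → Subsingleton (g.H i A)) :
    (∀ i, Subsingleton (g.H i (A ⧸ maximalIdeal A))) ↔ Subsingleton (g.H xs.length T) := by
  set I := Ideal.ofList xs with hI
  have hIm : I ≤ maximalIdeal A := Ideal.span_le.2 hm
  have hIne : I ≠ ⊤ := fun h ↦ (maximalIdeal.isMaximal A).ne_top (top_le_iff.1 (h ▸ hIm))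
  have : Nontrivial (A ⧸ I) := Ideal.Quotient.nontrivial_iff.2 hIne
  have : IsLocalRing (A ⧸ I) := .of_surjective' (Ideal.Quotient.mk I) Ideal.Quotient.mk_surjective
  have : IsArtinian A (A ⧸ I) := isArtinian_of_surjective_algebraMap (R := A ⧸ I)
    (by exact Ideal.Quotient.mk_surjective)
  have hlen : IsFiniteLength A (A ⧸ I) := isFiniteLength_iff_isNoetherian_isArtinian.2 ⟨inferInstance, this⟩
  have hlenM : ∀ (M : Type u) [AddCommGroup M] [Module A M] [Module.Finite A M],
      (∀ a ∈ I, ∀ m : M, a • m = 0) → IsFiniteLength A M := by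
    intro M _ _ _ hM
    obtain ⟨k, f, hf⟩ := I.exists_surjective_pi_quotient M hM
    have := isArtinian_of_surjective _ f hf
    exact isFiniteLength_iff_isNoetherian_isArtinian.2 ⟨inferInstance, this⟩
  have hItop : (Ideal.ofList xs • ⊤ : Submodule A A) = I := by simp [hI]
  have conc : ∀ (h : DeltaFunctor A) (N : ModuleCat.{u} A) (_ : h.H 0 A ≃ₗ[A] N)
      (_ : ∀ i, i ≠ 0 → Subsingleton (h.H i A)) (_ : IsCoregular xs N),
      (∀ i, i ≠ xs.length → Subsingleton (h.H i (A ⧸ I))) ∧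
      Nonempty (h.H xs.length (A ⧸ I) ≃ₗ[A] iterTorsion xs N) := by
    intro h N e hh hN
    obtain ⟨h₁, ⟨h₂⟩⟩ := h.quot_ofList_subsingleton_and_equiv xs hxs 0 hh e hN
    rw [hItop, zero_add] at *
    exact ⟨h₁, ⟨h₂⟩⟩
  obtain ⟨t₁, ⟨t₂⟩⟩ := conc t T et ht hT
  obtain ⟨g₁, -⟩ := conc g G eg hg hG
  let S := iterTorsion xs T
  let : Module (A ⧸ I) S := Module.IsTorsionBySet.module (I := I)
    (fun s a ↦ ofList_smul_iterTorsion xs T a a.2 s)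
  have : IsScalarTower A (A ⧸ I) S := Module.IsTorsionBySet.isScalarTower (I := I) _
  have hflat : Module.Flat (A ⧸ I) S := t.flat_of_subsingleton I xs.length
    (fun i hi ↦ t₁ i hi.ne) (fun M _ _ _ hM ↦ t.subsingleton_of_isFiniteLength_of_lt hlen n xs.length
      hn (fun i hi ↦ t₁ i hi.ne') _ (Nat.lt_succ_self _) (hlenM M hM)) t₂
  obtain ⟨ι, ⟨e⟩⟩ := Module.Flat.nonempty_linearEquiv_finsupp (A ⧸ I)
    ((isArtinianRing_iff_isNilpotent_maximalIdeal _).1 hart) S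
  have hne : Nonempty ι := by
    by_contra hemp
    rw [not_nonempty_iff] at hemp
    have : Subsingleton S := e.toEquiv.subsingleton
    exact not_subsingleton T (_root_.subsingleton_of_iterTorsion xs T hTtors this)
  have hgS : ∀ i, Subsingleton (g.obj i S) ↔ Subsingleton (g.H i (A ⧸ I)) := by
    intro i
    have := (g.mapEquiv i (M := S) (e.restrictScalars A)).toEquiv.subsingleton_congr
    rw [this]
    exact ⟨g.subsingleton_of_finsupp i ι, g.subsingleton_finsupp i ι⟩
  have key : (∀ i, Subsingleton (g.H i (A ⧸ maximalIdeal A))) ↔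
      Subsingleton (g.H xs.length (A ⧸ I)) := by
    refine ⟨fun h ↦ g.subsingleton_of_isFiniteLength _ (h _) hlen, fun h i ↦ ?_⟩
    refine g.subsingleton_of_lt I (i + 1) (fun j _ ↦ ?_) i (Nat.lt_succ_self i) _ fun a ha m ↦ ?_
    · by_cases hj : j = xs.length
      · rwa [hj]
      · exact g₁ j hj
    · obtain ⟨b, rfl⟩ := Ideal.Quotient.mk_surjective m
      exact Ideal.Quotient.eq_zero_iff_mem.2 (Ideal.mul_mem_right b _ (hIm ha))
  rw [key, ← hgS]
  exact ⟨g.subsingleton_of_iterTorsion xs T hT hTtors _,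
    g.subsingleton_iterTorsion xs T hT hTtors _ ((hgS _).2 (g₁ _ (by simp)))⟩

end DeltaFunctor

section

open MonoidalCategory HomologicalComplex

variable {A : Type u} [CommRing A] (F : ChainComplex (ModuleCat.{u} A) ℕ)

lemma homologyMap_linear_smul {K L : ChainComplex (ModuleCat.{u} A) ℕ} (a : A) (φ : K ⟶ L) (i : ℕ) :
    homologyMap (a • φ) i = a • homologyMap φ i :=
  ShortComplex.homologyMap_smul ((shortComplexFunctor (ModuleCat A) _ i).map φ) a

/-- The complex `M ⊗ F`, as a functor of the module `M`. -/
noncomputable def tensorComplex : ModuleCat.{u} A ⥤ ChainComplex (ModuleCat.{u} A) ℕ where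
  obj M := ((tensorLeft M).mapHomologicalComplex _).obj F
  map f := (NatTrans.mapHomologicalComplex ((tensoringLeft _).map f) _).app F

/-- The homology of `M ⊗ F`, as a linear function of linear maps. -/
noncomputable def tensorHomologyMap (i : ℕ) {M N : ModuleCat.{u} A} :
    (M →ₗ[A] N) →ₗ[A]
      (((tensorComplex F).obj M).homology i →ₗ[A] ((tensorComplex F).obj N).homology i) where
  toFun f := (homologyMap ((tensorComplex F).map (ModuleCat.ofHom f)) i).hom
  map_add' f g := by
    rw [← ModuleCat.hom_add, ← homologyMap_add]
    congr 2
    ext j : 2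
    refine LinearMap.ext fun z ↦ ?_
    exact LinearMap.congr_fun (LinearMap.rTensor_add (F.X j) f g) z
  map_smul' a f := by
    dsimp only [RingHom.id_apply]
    rw [← ModuleCat.hom_smul, ← homologyMap_linear_smul]
    congr 2
    ext j : 2
    refine LinearMap.ext fun z ↦ ?_
    exact LinearMap.congr_fun (LinearMap.rTensor_smul _ a f) z

lemma shortExact_tensorComplex (hF : ∀ i, Module.Flat A (F.X i)) {M N P : ModuleCat.{u} A}
    (f : M →ₗ[A] N) (g : N →ₗ[A] P) (hf : Function.Injective f) (hfg : Function.Exact f g)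
    (hg : Function.Surjective g) : ∃ w,
    (ShortComplex.mk ((tensorComplex F).map (ModuleCat.ofHom f))
      ((tensorComplex F).map (ModuleCat.ofHom g)) w).ShortExact := by
  have hex (j : ℕ) := rTensor_exact (F.X j) hfg hg
  refine ⟨?_, ?_⟩
  · ext j : 2
    exact LinearMap.ext fun z ↦ (hex j).apply_apply_eq_zero z
  · refine shortExact_of_degreewise_shortExact _ fun j ↦ ?_
    exact ModuleCat.shortComplex_shortExact _ (hex j)
      (Module.Flat.rTensor_preserves_injective_linearMap f hf) (LinearMap.rTensor_surjective _ hg)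

end

section

open MonoidalCategory HomologicalComplex

variable {A : Type u} [CommRing A]

lemma exists_cycle_of_d_eq_zero (K : ChainComplex (ModuleCat.{u} A) ℕ) (i : ℕ) (x : K.X i)
    (hx : ∀ j, K.d i j x = 0) : ∃ c : K.cycles i, K.iCycles i c = x :=
  (ShortComplex.moduleCat_exact_iff _).1
    (ShortComplex.exact_of_f_is_kernel (ShortComplex.mk (K.iCycles i) (K.d i _)
      (K.iCycles_d i ((ComplexShape.down ℕ).next i))) (K.cyclesIsKernel i _ rfl)) x (hx _)

/-- Every homology class has a representing cycle, and is the image of a class under a chain map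
as soon as the representing cycle is the image of a cycle. -/
lemma exists_representative {L : ChainComplex (ModuleCat.{u} A) ℕ} (i : ℕ) (z : L.homology i) :
    ∃ y : L.X i, (∀ j, L.d i j y = 0) ∧
      ∀ (K : ChainComplex (ModuleCat.{u} A) ℕ) (φ : K ⟶ L) (x : K.X i), (∀ j, K.d i j x = 0) →
        φ.f i x = y → ∃ w, homologyMap φ i w = z := by
  obtain ⟨c, rfl⟩ : ∃ c, L.homologyπ i c = z :=
    (ModuleCat.epi_iff_surjective _).1 inferInstance z
  refine ⟨L.iCycles i c, fun j ↦ ?_, fun K φ x hx hxy ↦ ?_⟩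
  · exact ConcreteCategory.congr_hom (L.iCycles_d i j) c
  · obtain ⟨c', rfl⟩ := exists_cycle_of_d_eq_zero K i x hx
    refine ⟨K.homologyπ i c', ?_⟩
    have h₁ := ConcreteCategory.congr_hom (homologyπ_naturality φ i) c'
    have h₂ := ConcreteCategory.congr_hom (cyclesMap_i φ i) c'
    rw [ConcreteCategory.comp_apply, ConcreteCategory.comp_apply] at h₁ h₂
    rw [h₁]
    congr 1
    exact (ModuleCat.mono_iff_injective (L.iCycles i)).1 inferInstance (h₂.trans hxy)

variable (F : ChainComplex (ModuleCat.{u} A) ℕ)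

/-- The homology of `- ⊗ F`, for a complex `F` of flat modules, as a `δ`-functor. -/
noncomputable def DeltaFunctor.ofFlatComplex (hF : ∀ i, Module.Flat A (F.X i)) :
    DeltaFunctor A where
  obj i M := ((tensorComplex F).obj M).homology i
  mapL i _ _ := tensorHomologyMap F i
  mapL_id i M := by
    refine (congrArg ModuleCat.Hom.hom ((congrArg (homologyMap · i)
      ((tensorComplex F).map_id M)).trans (homologyMap_id _ _)))
  mapL_comp i M N P f g := by
    refine (congrArg ModuleCat.Hom.hom ((congrArg (homologyMap · i)
      ((tensorComplex F).map_comp (ModuleCat.ofHom f) (ModuleCat.ofHom g))).trans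
        (homologyMap_comp _ _ _)))
  exact_mapL i M N P f g hf hfg hg := by
    obtain ⟨w, hS⟩ := shortExact_tensorComplex F hF f g hf hfg hg
    exact (ShortComplex.ShortExact.moduleCat_exact_iff_function_exact _).1 (hS.homology_exact₂ i)
  exists_δ i M N P f g hf hfg hg := by
    obtain ⟨w, hS⟩ := shortExact_tensorComplex F hF f g hf hfg hg
    have hi : (ComplexShape.down ℕ).Rel (i + 1) i := rfl
    exact ⟨(hS.δ (i + 1) i hi).hom,
      (ShortComplex.ShortExact.moduleCat_exact_iff_function_exact _).1 (hS.homology_exact₃ _ i hi),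
      (ShortComplex.ShortExact.moduleCat_exact_iff_function_exact _).1 (hS.homology_exact₁ _ i hi)⟩
  surjective_mapL_zero {M N P} f g _ _ hg z := by
    obtain ⟨y, -, h⟩ := exists_representative 0 z
    obtain ⟨x, rfl⟩ := LinearMap.rTensor_surjective (F.X 0) hg y
    exact h _ _ x (fun j ↦ by rw [HomologicalComplex.shape _ _ _ (Nat.succ_ne_zero j)]; rfl) rfl
  exists_fg i M z := by
    obtain ⟨y, hy, h⟩ := exists_representative i z
    obtain ⟨K, hK, hyK⟩ := TensorProduct.exists_finite_submodule_left_of_setFinite {y}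
      (Set.finite_singleton y)
    obtain ⟨x, rfl⟩ := Set.singleton_subset_iff.1 hyK
    refine ⟨K, Module.Finite.iff_fg.1 hK, h _
      ((tensorComplex F).map (ModuleCat.ofHom (X := K) K.subtype)) x (fun j ↦ ?_) rfl⟩
    apply Module.Flat.rTensor_preserves_injective_linearMap (M := F.X j) K.subtype
      K.subtype_injective
    refine Eq.trans ?_ ((hy j).trans (map_zero _).symm)
    exact (ConcreteCategory.congr_hom
      (((tensorComplex F).map (ModuleCat.ofHom (X := K) K.subtype)).comm i j) x).symm

/-- `ε : F₀ → N` makes the complex `F` a flat resolution of `N`. -/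
structure IsFlatResolution (N : Type u) [AddCommGroup N] [Module A N] (ε : F.X 0 →ₗ[A] N) :
    Prop where
  flat : ∀ i, Module.Flat A (F.X i)
  exact_succ : ∀ i, Function.Exact (F.d (i + 2) (i + 1)) (F.d (i + 1) i)
  exact_zero : Function.Exact (F.d 1 0) ε
  surjective : Function.Surjective ε

/-- Tensoring a complex with the ring does not change it. -/
noncomputable def tensorComplexSelfIso : (tensorComplex F).obj (ModuleCat.of A A) ≅ F :=
  Hom.isoOfComponents (fun i ↦ λ_ (F.X i))
    (fun i j _ ↦ (leftUnitor_naturality (F.d i j)).symm)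

lemma exactAt_succ_iff (K : ChainComplex (ModuleCat.{u} A) ℕ) (i : ℕ) :
    K.ExactAt (i + 1) ↔ Function.Exact (K.d (i + 2) (i + 1)) (K.d (i + 1) i) := by
  rw [K.exactAt_iff' (i + 2) (i + 1) i (by simp) (by simp)]
  exact ShortComplex.ShortExact.moduleCat_exact_iff_function_exact _

lemma subsingleton_homology_iff (K : ChainComplex (ModuleCat.{u} A) ℕ) (i : ℕ) :
    Subsingleton (K.homology i) ↔ K.ExactAt i := by
  rw [exactAt_iff_isZero_homology, ModuleCat.isZero_iff_subsingleton]

namespace IsFlatResolution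

variable {F} {N : Type u} [AddCommGroup N] [Module A N] {ε : F.X 0 →ₗ[A] N}
  (h : IsFlatResolution F N ε)

include h

/-- The `δ`-functor `Tor(-, N)`, computed by a flat resolution of `N`. -/
noncomputable abbrev deltaFunctor : DeltaFunctor A := .ofFlatComplex F h.flat

lemma subsingleton_H_self (i : ℕ) (hi : i ≠ 0) : Subsingleton (h.deltaFunctor.H i A) := by
  obtain ⟨i, rfl⟩ := Nat.exists_eq_succ_of_ne_zero hi
  have h₁ := (subsingleton_homology_iff F (i + 1)).2 ((exactAt_succ_iff F i).2 (h.exact_succ i))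
  exact (homologyMapIso (tensorComplexSelfIso F) (i + 1)).toLinearEquiv.toEquiv.subsingleton

lemma nonempty_H_zero_self : Nonempty (h.deltaFunctor.H 0 A ≃ₗ[A] N) := by
  have h₁ := F.opcyclesIsCokernel 1 0 (by simp)
  have hex : (ShortComplex.mk (F.d 1 0) (ModuleCat.ofHom (Y := N) ε) (by
      ext x; exact h.exact_zero.apply_apply_eq_zero x)).Exact :=
    (ShortComplex.ShortExact.moduleCat_exact_iff_function_exact _).2 h.exact_zero
  have hepi : Epi (ModuleCat.ofHom (Y := N) ε) := (ModuleCat.epi_iff_surjective _).2 h.surjective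
  exact ⟨(homologyMapIso (tensorComplexSelfIso F) 0 ≪≫ F.isoHomologyι₀ ≪≫
    h₁.coconePointUniqueUpToIso hex.gIsCokernel).toLinearEquiv⟩

lemma subsingleton_H (i : ℕ) (hi : Subsingleton (F.X i)) (M : Type u) [AddCommGroup M]
    [Module A M] : Subsingleton (h.deltaFunctor.H i M) := by
  refine (subsingleton_homology_iff _ i).2 (.of_isZero ?_)
  exact ModuleCat.isZero_of_subsingleton (ModuleCat.of A (TensorProduct A M (F.X i)))

end IsFlatResolution

end

section

open MonoidalCategory HomologicalComplex TensorProduct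

variable (R A : Type u) [CommRing R] [CommRing A] [Algebra R A]

/-- Base change of modules along an algebra, as a functor. -/
noncomputable def baseChangeFunctor : ModuleCat.{u} R ⥤ ModuleCat.{u} A where
  obj N := ModuleCat.of A (A ⊗[R] N)
  map f := ModuleCat.ofHom (f.hom.baseChange A)
  map_id _ := by ext; rfl
  map_comp _ _ := by ext; rfl

instance : (baseChangeFunctor R A).Additive where
  map_add {M N f g} := by
    refine ModuleCat.hom_ext ?_
    exact LinearMap.baseChange_add _ _

lemma exactAt_iff_functionExact {A : Type u} [CommRing A] (K : ChainComplex (ModuleCat.{u} A) ℕ)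
    (i : ℕ) : K.ExactAt i ↔
      Function.Exact (K.d (i + 1) i) (K.d i ((ComplexShape.down ℕ).next i)) := by
  rw [K.exactAt_iff' (i + 1) i _ (by simp) rfl]
  exact ShortComplex.ShortExact.moduleCat_exact_iff_function_exact _

variable {R}

/-- The base change of a projective resolution along a flat algebra is a flat resolution, and it
computes `Tor`. -/
lemma exists_isFlatResolution_baseChange [Module.Flat R A] (G : Type u) [AddCommGroup G]
    [Module R G] : ∃ (F : ChainComplex (ModuleCat.{u} A) ℕ) (ε : F.X 0 →ₗ[A] (A ⊗[R] G))
      (h : IsFlatResolution F (A ⊗[R] G) ε), ∀ (i : ℕ) (M : Type u) [AddCommGroup M] [Module R M]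
      [Module A M] [IsScalarTower R A M], Subsingleton (TorM R i M G) ↔
        Subsingleton (h.deltaFunctor.H i M) := by
  let P := ProjectiveResolution.of (ModuleCat.of R G)
  let π : P.complex.X 0 →ₗ[R] G := (P.π.f 0).hom
  have hπ : Function.Surjective π := (ModuleCat.epi_iff_surjective (P.π.f 0)).1 inferInstance
  have h₀ : Function.Exact (P.complex.d 1 0) π :=
    (ShortComplex.ShortExact.moduleCat_exact_iff_function_exact _).1 P.exact₀
  have hproj (i : ℕ) : Module.Projective R (P.complex.X i) :=
    (IsProjective.iff_projective _).2 (P.projective i)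
  let F := ((baseChangeFunctor R A).mapHomologicalComplex _).obj P.complex
  have h : IsFlatResolution F (A ⊗[R] G) (π.baseChange A) :=
    { flat i := by
        have := hproj i
        exact inferInstanceAs (Module.Flat A (A ⊗[R] (P.complex.X i)))
      exact_succ i := Module.Flat.lTensor_exact A
        ((exactAt_succ_iff _ i).1 (P.complex_exactAt_succ i))
      exact_zero := Module.Flat.lTensor_exact A h₀
      surjective := LinearMap.lTensor_surjective A hπ }
  refine ⟨F, π.baseChange A, h, fun i M _ _ _ _ ↦ ?_⟩
  let K := ((tensorLeft (ModuleCat.of R M)).mapHomologicalComplex _).obj P.complex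
  have e₁ : TorM R i M G ≅ K.homology i := P.isoLeftDerivedObj _ i
  rw [e₁.toLinearEquiv.toEquiv.subsingleton_congr, subsingleton_homology_iff,
    exactAt_iff_functionExact]
  refine Iff.trans ?_ ((exactAt_iff_functionExact _ i).symm.trans
    (subsingleton_homology_iff ((tensorComplex F).obj (ModuleCat.of A M)) i).symm)
  let e (j : ℕ) := (AlgebraTensorModule.cancelBaseChange R A A M (P.complex.X j)).toAddEquiv
  have comm (j k : ℕ) (z : M ⊗[A] (A ⊗[R] (P.complex.X j))) :
      e k (((P.complex.d j k).hom.baseChange A).lTensor M z) =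
        (P.complex.d j k).hom.lTensor M (e j z) := by
    induction z with
    | zero => simp
    | add => simp_all
    | tmul m z =>
      induction z with
      | zero => simp
      | add => simp_all [tmul_add]
      | tmul a z => simp [e]
  let f (j k : ℕ) : M ⊗[A] (A ⊗[R] (P.complex.X j)) →+ M ⊗[A] (A ⊗[R] (P.complex.X k)) :=
    (((P.complex.d j k).hom.baseChange A).lTensor M).toAddMonoidHom
  let g (j k : ℕ) : M ⊗[R] (P.complex.X j) →+ M ⊗[R] (P.complex.X k) :=
    ((P.complex.d j k).hom.lTensor M).toAddMonoidHom
  have comm' (j k : ℕ) : (g j k).comp (e j).toAddMonoidHom = (e k).toAddMonoidHom.comp (f j k) :=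
    AddMonoidHom.ext fun z ↦ (comm j k z).symm
  exact Function.Exact.iff_of_ladder_addEquiv (e (i + 1)) (e i) (e _) (comm' _ _) (comm' _ _)

end

section

variable {A : Type u} [CommRing A]

lemma Module.Injective.exists_extension_of_ker_le {X Y E : Type u} [AddCommGroup X] [Module A X]
    [AddCommGroup Y] [Module A Y] [AddCommGroup E] [Module A E] (hE : Module.Injective A E)
    (f : X →ₗ[A] Y) (φ : X →ₗ[A] E) (h : LinearMap.ker f ≤ LinearMap.ker φ) :
    ∃ ψ : Y →ₗ[A] E, ∀ x, ψ (f x) = φ x := by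
  obtain ⟨ψ, hψ⟩ := hE.out ((LinearMap.ker f).liftQ f le_rfl)
    (LinearMap.ker_eq_bot.1 (Submodule.ker_liftQ_eq_bot _ _ _ le_rfl)) ((LinearMap.ker f).liftQ φ h)
  exact ⟨ψ, fun x ↦ by simpa using hψ (Submodule.Quotient.mk x)⟩

/-- Homomorphisms between injective modules over a noetherian ring form a flat module. -/
lemma Module.Flat.linearMap_of_injective [IsNoetherianRing A] {I E : Type u} [AddCommGroup I]
    [Module A I] [AddCommGroup E] [Module A E] (hI : Module.Injective A I)
    (hE : Module.Injective A E) : Module.Flat A (I →ₗ[A] E) := by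
  refine Module.Flat.of_forall_isTrivialRelation fun {l a φ} hφ ↦ ?_
  let p : (Fin l → A) →ₗ[A] A := Fintype.linearCombination A a
  obtain ⟨k, b, hb⟩ := Submodule.fg_iff_exists_fin_generating_family.1
    (IsNoetherian.noetherian (LinearMap.ker p))
  let β : (Fin l → I) →ₗ[A] (Fin k → I) :=
    LinearMap.pi fun j ↦ ∑ i, b j i • LinearMap.proj i
  let Φ : (Fin l → I) →ₗ[A] E := ∑ i, φ i ∘ₗ LinearMap.proj i
  have hker : LinearMap.ker β ≤ LinearMap.ker Φ := by
    intro e he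
    have he' (j : Fin k) : ∑ i, b j i • e i = 0 := by
      have := congrFun (LinearMap.mem_ker.1 he) j
      simpa [β] using this
    obtain ⟨ψ, hψ⟩ := hI.exists_extension_of_ker_le p (Fintype.linearCombination A e) (by
      rw [← hb, Submodule.span_le]
      rintro _ ⟨j, rfl⟩
      simpa [Fintype.linearCombination_apply] using he' j)
    have hei (i : Fin l) : e i = a i • ψ 1 := by
      have := hψ (Pi.single i 1)
      simp only [p, Fintype.linearCombination_apply_single, one_smul] at this
      rw [← this, ← map_smul, smul_eq_mul, mul_one]
    have := LinearMap.congr_fun hφ (ψ 1)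
    simpa [Φ, hei] using this
  obtain ⟨Ψ, hΨ⟩ := hE.exists_extension_of_ker_le β Φ hker
  refine ⟨k, fun i j ↦ b j i, fun j ↦ Ψ ∘ₗ LinearMap.single A (fun _ ↦ I) j, fun i ↦ ?_, fun j ↦ ?_⟩
  · ext e
    have := hΨ (Pi.single i e)
    have h₁ : Φ (Pi.single i e) = φ i e := by
      simp only [Φ, LinearMap.sum_apply, LinearMap.comp_apply, LinearMap.proj_apply]
      rw [Finset.sum_eq_single i] <;> simp +contextual
    have h₂ : β (Pi.single i e) = ∑ j, Pi.single j (b j i • e) := by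
      ext j
      simp only [β, LinearMap.pi_apply, LinearMap.sum_apply, LinearMap.smul_apply,
        LinearMap.proj_apply, Finset.sum_apply]
      rw [Finset.sum_eq_single i, Finset.sum_eq_single j] <;> simp +contextual
    rw [← h₁, ← this, h₂]
    simp [Pi.single_smul]
  · have : b j ∈ LinearMap.ker p := hb ▸ Submodule.subset_span ⟨j, rfl⟩
    simpa [p, Fintype.linearCombination_apply, mul_comm] using this

end

section

open HomologicalComplex

variable {A : Type u} [CommRing A]

lemma IsFlatResolution.single (N : Type u) [AddCommGroup N] [Module A N] [Module.Flat A N] :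
    IsFlatResolution ((ChainComplex.single₀ (ModuleCat.{u} A)).obj (ModuleCat.of A N)) N
      LinearMap.id := by
  have h (i : ℕ) : Subsingleton
      (((ChainComplex.single₀ (ModuleCat.{u} A)).obj (ModuleCat.of A N)).X (i + 1)) :=
    ModuleCat.isZero_iff_subsingleton.1 (isZero_single_obj_X _ 0 _ _ (Nat.succ_ne_zero i))
  constructor
  · rintro (_ | i)
    · assumption
    · have := h i
      infer_instance
  · intro i x
    rw [(h i).elim x 0]
    simp
  · intro x
    constructor
    · rintro rfl
      exact ⟨0, map_zero _⟩
    · rintro ⟨y, rfl⟩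
      rw [(h 0).elim y 0]
      exact map_zero (((ChainComplex.single₀ (ModuleCat.{u} A)).obj (ModuleCat.of A N)).d 1 0).hom
  · exact Function.surjective_id

lemma IsFlatResolution.augment {F : ChainComplex (ModuleCat.{u} A) ℕ} {L X N : Type u}
    [AddCommGroup L] [Module A L] [AddCommGroup X] [Module A X] [AddCommGroup N] [Module A N]
    {ε : F.X 0 →ₗ[A] L} (h : IsFlatResolution F L ε) [Module.Flat A X] {f : L →ₗ[A] X}
    {g : X →ₗ[A] N} (hf : Function.Injective f) (hfg : Function.Exact f g)
    (hg : Function.Surjective g) :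
    ∃ w, IsFlatResolution (F.augment (ModuleCat.ofHom (Y := X) (f ∘ₗ ε)) w) N g := by
  refine ⟨?_, ?_, ?_, ?_, hg⟩
  · ext x
    exact (congrArg f (h.exact_zero.apply_apply_eq_zero x)).trans (map_zero f)
  · rintro (_ | i)
    · assumption
    · exact h.flat i
  · rintro (_ | i)
    · intro x
      exact ((map_eq_zero_iff f hf).trans (h.exact_zero x))
    · exact h.exact_succ i
  · intro x
    refine (hfg x).trans ⟨?_, ?_⟩
    · rintro ⟨y, rfl⟩
      obtain ⟨z, rfl⟩ := h.surjective y
      exact ⟨z, rfl⟩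
    · rintro ⟨z, rfl⟩
      exact ⟨ε z, rfl⟩

/-- Homomorphisms from a module of finite injective dimension to an injective module have a bounded
flat resolution. -/
lemma exists_isFlatResolution_linearMap [IsNoetherianRing A] {E : Type u} [AddCommGroup E]
    [Module A E] (hE : Module.Injective A E) (n : ℕ) (C : ModuleCat.{u} A) (hC : InjDimLE A n C) :
    ∃ (F : ChainComplex (ModuleCat.{u} A) ℕ) (ε : F.X 0 →ₗ[A] (C →ₗ[A] E)),
      IsFlatResolution F (C →ₗ[A] E) ε ∧ ∀ i, n < i → Subsingleton (F.X i) := by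
  induction n generalizing C with
  | zero =>
    have : Module.Flat A (C →ₗ[A] E) := .linearMap_of_injective hC hE
    refine ⟨_, _, .single (C →ₗ[A] E), fun i hi ↦ ?_⟩
    exact ModuleCat.isZero_iff_subsingleton.1 (isZero_single_obj_X _ 0 _ _ hi.ne')
  | succ n ih =>
    obtain ⟨I, hI, ι, hι, hC'⟩ := hC
    obtain ⟨F, ε, h, hF⟩ := ih _ hC'
    have : Module.Flat A (I →ₗ[A] E) := .linearMap_of_injective hI hE
    have hinj : Function.Injective (LinearMap.lcomp A E (Submodule.mkQ (LinearMap.range ι))) :=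
      fun _ _ h ↦ (LinearMap.cancel_right (Submodule.mkQ_surjective _)).1 h
    have hexact : Function.Exact (LinearMap.lcomp A E (Submodule.mkQ (LinearMap.range ι)))
        (LinearMap.lcomp A E ι) := by
      intro φ
      constructor
      · intro hφ
        have hle : LinearMap.range ι ≤ LinearMap.ker φ := by
          rintro _ ⟨c, rfl⟩
          exact LinearMap.congr_fun hφ c
        exact ⟨(LinearMap.range ι).liftQ φ hle, (LinearMap.range ι).liftQ_mkQ φ hle⟩
      · rintro ⟨ψ, rfl⟩
        ext c
        have : (LinearMap.range ι).mkQ (ι c) = 0 := (Submodule.Quotient.mk_eq_zero _).2 ⟨c, rfl⟩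
        simp [this]
    have hsurj : Function.Surjective (LinearMap.lcomp A E ι) := by
      intro φ
      obtain ⟨ψ, hψ⟩ := hE.out ι hι φ
      exact ⟨ψ, LinearMap.ext hψ⟩
    obtain ⟨w, hw⟩ := h.augment hinj hexact hsurj
    refine ⟨_, _, hw, ?_⟩
    rintro (_ | i) hi
    · exact absurd hi (Nat.not_lt_zero _)
    · exact hF i (Nat.lt_of_succ_lt_succ hi)

end

section

open scoped Pointwise
open TensorProduct

variable {A : Type u} [CommRing A]

/-- Homomorphisms killed by `x` are homomorphisms from the quotient by `x`. -/
def quotSMulTopLinearMapEquiv (x : A) (N E : Type*) [AddCommGroup N] [Module A N] [AddCommGroup E]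
    [Module A E] : (QuotSMulTop x N →ₗ[A] E) ≃ₗ[A] Submodule.torsionBy A (N →ₗ[A] E) x where
  toFun φ := ⟨φ ∘ₗ Submodule.mkQ _, by
    ext n
    have : (x • ⊤ : Submodule A N).mkQ (x • n) = 0 :=
      (Submodule.Quotient.mk_eq_zero _).2 (Submodule.smul_mem_pointwise_smul _ _ _ trivial)
    simpa using congrArg φ this⟩
  map_add' _ _ := rfl
  map_smul' _ _ := rfl
  invFun φ := (x • ⊤ : Submodule A N).liftQ φ.1 (by
    intro n hn
    obtain ⟨m, -, rfl⟩ := (Submodule.mem_smul_pointwise_iff_exists _ _ _).1 hn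
    have := LinearMap.congr_fun ((Submodule.mem_torsionBy_iff _ _).1 φ.2) m
    exact (map_smul φ.1 x m).trans this)
  left_inv φ := Submodule.linearMap_qext _ (by simp)
  right_inv φ := Subtype.ext (by simp)

lemma IsCoregular.linearMap (xs : List A) (N E : Type u) [AddCommGroup N] [Module A N]
    [AddCommGroup E] [Module A E] (hE : Module.Injective A E)
    (hN : RingTheory.Sequence.IsWeaklyRegular N xs) :
    IsCoregular xs (ModuleCat.of A (N →ₗ[A] E)) := by
  induction xs generalizing N with
  | nil => trivial
  | cons x xs ih =>
    obtain ⟨hx, hxs⟩ := (RingTheory.Sequence.isWeaklyRegular_cons_iff _ _ _).1 hN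
    refine ⟨fun φ ↦ ?_, (ih _ hxs).congr (quotSMulTopLinearMapEquiv x N E)⟩
    obtain ⟨ψ, hψ⟩ := hE.out (x • (LinearMap.id : N →ₗ[A] N)) hx φ
    refine ⟨ψ, LinearMap.ext fun n ↦ ?_⟩
    simpa using hψ n

lemma IsCoregular.of_injective (xs : List A) (E : Type u) [AddCommGroup E] [Module A E]
    (hE : Module.Injective A E) (hxs : RingTheory.Sequence.IsWeaklyRegular A xs) :
    IsCoregular xs (ModuleCat.of A E) :=
  (IsCoregular.linearMap xs A E hE hxs).congr (LinearMap.ringLmapEquivSelf A A E)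

/-- If every module of a class is a quotient of a module on which `xs` is coregular, with kernel in
the class, then `xs` is coregular on the modules of the class. -/
lemma IsCoregular.of_forall_exists (xs : List A) (P : ModuleCat.{u} A → Prop)
    (hP : ∀ M, P M → ∃ (E M' : ModuleCat.{u} A) (f : M' →ₗ[A] E) (g : E →ₗ[A] M),
      IsCoregular xs E ∧ P M' ∧ Function.Injective f ∧ Function.Exact f g ∧ Function.Surjective g)
    (M : ModuleCat.{u} A) (hM : P M) : IsCoregular xs M := by
  induction xs generalizing P M with
  | nil => trivial
  | cons x xs ih =>
    have hdiv : ∀ M, P M → ∀ m : M, ∃ m' : M, x • m' = m := by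
      intro M hM m
      obtain ⟨E, M', f, g, hE, -, -, -, hg⟩ := hP M hM
      obtain ⟨e, rfl⟩ := hg m
      obtain ⟨e', rfl⟩ := hE.1 e
      exact ⟨g e', (map_smul g x e').symm⟩
    refine ⟨hdiv M hM, ih (fun N ↦ ∃ M, P M ∧ N = ModuleCat.of A (Submodule.torsionBy A M x)) ?_ _
      ⟨M, hM, rfl⟩⟩
    rintro _ ⟨M, hM, rfl⟩
    obtain ⟨E, M', f, g, hE, hM', hf, hfg, hg⟩ := hP M hM
    let res {M N : ModuleCat.{u} A} (f : M →ₗ[A] N) :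
        Submodule.torsionBy A M x →ₗ[A] Submodule.torsionBy A N x :=
      f.restrict fun m hm ↦ by
        rw [Submodule.mem_torsionBy_iff] at hm ⊢
        rw [← map_smul, hm, map_zero]
    refine ⟨_, _, res f, res g, hE.2, ⟨M', hM', rfl⟩, fun a b h ↦ ?_, fun e ↦ ⟨fun h ↦ ?_, ?_⟩,
      fun m ↦ ?_⟩
    · exact Subtype.ext (hf (congrArg Subtype.val h))
    · obtain ⟨m', hm'⟩ := (hfg e.1).1 (congrArg Subtype.val h)
      refine ⟨⟨m', (Submodule.mem_torsionBy_iff _ _).2 (hf ?_)⟩, Subtype.ext hm'⟩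
      rw [map_smul, hm', map_zero]
      exact (Submodule.mem_torsionBy_iff _ _).1 e.2
    · rintro ⟨m', rfl⟩
      exact Subtype.ext (hfg.apply_apply_eq_zero m'.1)
    · obtain ⟨e, he⟩ := hg m.1
      obtain ⟨m', hm'⟩ := (hfg (x • e)).1 (by
        rw [map_smul, he]
        exact (Submodule.mem_torsionBy_iff _ _).1 m.2)
      obtain ⟨m'', rfl⟩ := hdiv M' hM' m'
      refine ⟨⟨e - f m'', (Submodule.mem_torsionBy_iff _ _).2 ?_⟩, Subtype.ext ?_⟩
      · rw [smul_sub, ← hm', map_smul, sub_self]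
      · exact (map_sub g _ _).trans (by rw [he, hfg.apply_apply_eq_zero, sub_zero])

variable {R : Type u} [CommRing R]

lemma Module.Injective.tensorProduct [IsNoetherianRing R] (S : Submonoid R) [Algebra R A]
    [IsLocalization S A] {E : Type u} [AddCommGroup E] [Module R E] (hE : Module.Injective R E) :
    Module.Injective A (A ⊗[R] E) :=
  Module.injective_of_isLocalizedModule S (TensorProduct.mk R A E 1)

lemma GorensteinInjective.isCoregular [IsNoetherianRing R] (S : Submonoid R) [Algebra R A]
    [IsLocalization S A] {G : Type u} [AddCommGroup G] [Module R G] (hG : GorensteinInjective R G)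
    (xs : List A) (hxs : RingTheory.Sequence.IsWeaklyRegular A xs) :
    IsCoregular xs (ModuleCat.of A (A ⊗[R] G)) := by
  obtain ⟨X, ⟨e⟩⟩ := hG
  have : Module.Flat R A := IsLocalization.flat A S
  refine (IsCoregular.of_forall_exists xs
    (fun M ↦ ∃ i : ℤ, M = ModuleCat.of A (A ⊗[R] (LinearMap.range (X.d i)))) ?_ _ ⟨0, rfl⟩).congr
    (e.symm.baseChange R A _ _)
  rintro _ ⟨j, rfl⟩
  obtain ⟨i, rfl⟩ : ∃ i, j = i + 1 := ⟨j - 1, by ring⟩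
  have hex : Function.Exact (LinearMap.range (X.d i)).subtype (X.d (i + 1)).rangeRestrict := by
    rw [X.exct i]
    intro y
    simp [Subtype.ext_iff]
  exact ⟨_, _, (LinearMap.range (X.d i)).subtype.baseChange A,
    (X.d (i + 1)).rangeRestrict.baseChange A,
    .of_injective xs _ ((X.inj (i + 1)).tensorProduct S) hxs, ⟨i, rfl⟩,
    Module.Flat.lTensor_preserves_injective_linearMap _ (Submodule.subtype_injective _),
    Module.Flat.lTensor_exact A hex,
    LinearMap.lTensor_surjective A (X.d (i + 1)).surjective_rangeRestrict⟩

end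

section

open TensorProduct

variable {R : Type u} [CommRing R]

lemma Module.Injective.of_linearEquiv {E E' : Type u} [AddCommGroup E] [Module R E]
    [AddCommGroup E'] [Module R E'] (e : E ≃ₗ[R] E') (hE : Module.Injective R E) :
    Module.Injective R E' := by
  refine ⟨fun X Y _ _ _ _ f hf g ↦ ?_⟩
  obtain ⟨h, hh⟩ := hE.out f hf (e.symm.toLinearMap ∘ₗ g)
  exact ⟨e.toLinearMap ∘ₗ h, fun x ↦ by simp [hh]⟩

lemma InjDimLE.congr {n : ℕ} {M M' : ModuleCat.{u} R} (hM : InjDimLE R n M) (e : M ≃ₗ[R] M') :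
    InjDimLE R n M' := by
  cases n with
  | zero => exact Module.Injective.of_linearEquiv e hM
  | succ n =>
    obtain ⟨I, hI, ι, hι, h⟩ := hM
    refine ⟨I, hI, ι ∘ₗ e.symm.toLinearMap, hι.comp e.symm.injective, ?_⟩
    rwa [LinearMap.range_comp_of_range_eq_top _ e.symm.range]

lemma InjDimLE.tensorProduct [IsNoetherianRing R] {A : Type u} [CommRing A] [Algebra R A]
    (S : Submonoid R) [IsLocalization S A] {n : ℕ} {M : ModuleCat.{u} R} (hM : InjDimLE R n M) :
    InjDimLE A n (ModuleCat.of A (A ⊗[R] M)) := by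
  have : Module.Flat R A := IsLocalization.flat A S
  induction n generalizing M with
  | zero => exact Module.Injective.tensorProduct S hM
  | succ n ih =>
    obtain ⟨I, hI, ι, hι, h⟩ := hM
    have hex : Function.Exact (ι.baseChange A) ((LinearMap.range ι).mkQ.baseChange A) :=
      Module.Flat.lTensor_exact A fun x ↦ by simp
    let e : A ⊗[R] (I ⧸ LinearMap.range ι) ≃ₗ[A] (A ⊗[R] I ⧸ LinearMap.range (ι.baseChange A)) :=
      (hex.linearEquivOfSurjective
        (LinearMap.lTensor_surjective A (Submodule.mkQ_surjective _))).symm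
    exact ⟨ModuleCat.of A (A ⊗[R] I), hI.tensorProduct S, ι.baseChange A,
      Module.Flat.lTensor_preserves_injective_linearMap _ hι, (ih h).congr e⟩

section InjectiveHull

variable {p : Ideal R} {E : Type u} [AddCommGroup E] [Module R E]

lemma IsInjectiveHull.exists_smul_eq (hE : IsInjectiveHull R (R ⧸ p) E)
    {e : E} (he : e ≠ 0) : ∃ r : R, r • e ≠ 0 ∧ ∃ (ι : (R ⧸ p) →ₗ[R] E) (s : R ⧸ p),
      Function.Injective ι ∧ ι s = r • e := by
  obtain ⟨-, ι, hι, h⟩ := hE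
  obtain ⟨x, ⟨hx, y, rfl⟩, hx0⟩ := Submodule.exists_mem_ne_zero_of_ne_bot
    (h (Submodule.span R {e}) (by simpa using he))
  obtain ⟨r, hr⟩ := Submodule.mem_span_singleton.1 hx
  exact ⟨r, hr ▸ hx0, ι, y, hι, hr.symm⟩

lemma IsInjectiveHull.isSMulRegular [p.IsPrime] (hE : IsInjectiveHull R (R ⧸ p) E) {s : R}
    (hs : s ∉ p) : IsSMulRegular E s := by
  refine isSMulRegular_iff_right_eq_zero_of_smul.2 fun e h ↦ ?_
  by_contra he
  obtain ⟨r, hr, ι, y, hι, hy⟩ := hE.exists_smul_eq he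
  obtain ⟨y, rfl⟩ := Ideal.Quotient.mk_surjective y
  have : Ideal.Quotient.mk p (s * y) = 0 := hι (by
    have h1 : Ideal.Quotient.mk p (s * y) = s • Ideal.Quotient.mk p y := rfl
    rw [h1, map_smul, hy, smul_comm, h, smul_zero, map_zero])
  rcases Ideal.IsPrime.mem_or_mem ‹_› (Ideal.Quotient.eq_zero_iff_mem.1 this) with h' | h'
  · exact hs h'
  · exact hr (by rw [← hy, Ideal.Quotient.eq_zero_iff_mem.2 h', map_zero])

lemma IsInjectiveHull.bijective_smul [p.IsPrime] (hE : IsInjectiveHull R (R ⧸ p) E) {s : R}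
    (hs : s ∉ p) : Function.Bijective (s • · : E → E) := by
  refine ⟨hE.isSMulRegular hs, fun e ↦ ?_⟩
  obtain ⟨h, hh⟩ := hE.1.out (s • (LinearMap.id : E →ₗ[R] E)) (hE.isSMulRegular hs) LinearMap.id
  exact ⟨h e, by simpa using hh e⟩

lemma IsInjectiveHull.exists_pow_smul_eq_zero [IsNoetherianRing R]
    (hE : IsInjectiveHull R (R ⧸ p) E) {a : R} (ha : a ∈ p) (e : E) : ∃ n : ℕ, a ^ n • e = 0 := by
  let f : ℕ →o Submodule R R := ⟨fun n ↦ LinearMap.ker (LinearMap.toSpanSingleton R E (a ^ n • e)),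
    monotone_nat_of_le_succ fun n r hr ↦ by
      simp only [LinearMap.mem_ker, LinearMap.toSpanSingleton_apply] at hr ⊢
      rw [pow_succ', mul_smul, smul_comm, hr, smul_zero]⟩
  obtain ⟨n, hn⟩ := monotone_stabilizes_iff_noetherian.2 (inferInstanceAs (IsNoetherian R R)) f
  refine ⟨n, ?_⟩
  by_contra he
  obtain ⟨r, hr, ι, y, hι, hy⟩ := hE.exists_smul_eq he
  obtain ⟨y, rfl⟩ := Ideal.Quotient.mk_surjective y
  refine hr ?_
  have h1 : r ∈ f (n + 1) := by
    simp only [f, OrderHom.coe_mk, LinearMap.mem_ker, LinearMap.toSpanSingleton_apply]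
    rw [pow_succ', mul_smul, smul_comm, ← hy, ← map_smul]
    have h1 : a • Ideal.Quotient.mk p y = Ideal.Quotient.mk p (a * y) := rfl
    rw [h1, Ideal.Quotient.eq_zero_iff_mem.2 (Ideal.mul_mem_right _ _ ha), map_zero]
  rw [← hn (n + 1) n.le_succ] at h1
  simpa [f] using h1

end InjectiveHull

end

section

open TensorProduct

lemma IsPowTorsion.linearMap {A : Type u} [CommRing A] {x : A} {N E : Type*} [AddCommGroup N]
    [Module A N] [Module.Finite A N] [AddCommGroup E] [Module A E] (hE : IsPowTorsion x E) :
    IsPowTorsion x (N →ₗ[A] E) := by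
  intro φ
  suffices ∀ P : Submodule A N, P.FG → ∃ k : ℕ, P ≤ LinearMap.ker (x ^ k • φ) by
    obtain ⟨k, hk⟩ := this ⊤ Module.Finite.fg_top
    exact ⟨k, LinearMap.ext fun n ↦ hk trivial⟩
  intro P hP
  induction P, hP using Submodule.fg_induction with
  | singleton n =>
    obtain ⟨k, hk⟩ := hE (φ n)
    exact ⟨k, by simpa [Submodule.span_le] using hk⟩
  | sup P Q _ _ hP hQ =>
    obtain ⟨k, hk⟩ := hP
    obtain ⟨l, hl⟩ := hQ
    refine ⟨k + l, sup_le (fun n hn ↦ ?_) fun n hn ↦ ?_⟩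
    · rw [add_comm, pow_add, mul_smul]
      simpa using congrArg (x ^ l • ·) (show x ^ k • φ n = 0 from hk hn)
    · rw [pow_add, mul_smul]
      simpa using congrArg (x ^ k • ·) (show x ^ l • φ n = 0 from hl hn)

variable {R : Type u} [CommRing R] {p : Ideal R} [p.IsPrime] {E : Type u} [AddCommGroup E]
  [Module R E]

/-- The injective hull of `R ⧸ p` is its own localization at `p`. -/
lemma IsInjectiveHull.isLocalizedModule_id (hE : IsInjectiveHull R (R ⧸ p) E) :
    IsLocalizedModule p.primeCompl (LinearMap.id : E →ₗ[R] E) where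
  map_units s := (Module.End.isUnit_iff _).2 (hE.bijective_smul s.2)
  surj e := ⟨⟨e, 1⟩, by simp⟩
  exists_of_eq h := ⟨1, by simpa using h⟩

lemma IsInjectiveHull.nonempty_linearEquiv (hE : IsInjectiveHull R (R ⧸ p) E) :
    Nonempty (E ≃ₗ[R] Localization.AtPrime p ⊗[R] E) :=
  have := hE.isLocalizedModule_id
  ⟨IsLocalizedModule.linearEquiv p.primeCompl (LinearMap.id : E →ₗ[R] E)
    (TensorProduct.mk R (Localization.AtPrime p) E 1)⟩

lemma IsInjectiveHull.isPowTorsion [IsNoetherianRing R] (hE : IsInjectiveHull R (R ⧸ p) E)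
    {x : Localization.AtPrime p} (hx : x ∈ IsLocalRing.maximalIdeal (Localization.AtPrime p)) :
    IsPowTorsion x (Localization.AtPrime p ⊗[R] E) := by
  intro m
  obtain ⟨ε⟩ := hE.nonempty_linearEquiv
  obtain ⟨a, s, rfl⟩ := IsLocalization.exists_mk'_eq p.primeCompl x
  have ha : a ∈ p := (IsLocalization.AtPrime.mk'_mem_maximal_iff _ p a s).1 hx
  obtain ⟨n, hn⟩ := hE.exists_pow_smul_eq_zero ha (ε.symm m)
  rw [← map_smul, ε.symm.map_eq_zero_iff] at hn
  refine ⟨n, ((IsLocalization.map_units (Localization.AtPrime p) s).pow n).smul_eq_zero.1 ?_⟩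
  rw [← mul_smul, ← mul_pow, mul_comm, IsLocalization.mk'_spec, ← map_pow, algebraMap_smul, hn]

variable (D : Type u) [AddCommGroup D] [Module R D]

lemma IsInjectiveHull.nonempty_linearMap_equiv (hE : IsInjectiveHull R (R ⧸ p) E) :
    Nonempty ((D →ₗ[R] E) ≃ₗ[R] (Localization.AtPrime p ⊗[R] D →ₗ[Localization.AtPrime p]
      Localization.AtPrime p ⊗[R] E)) :=
  hE.nonempty_linearEquiv.map fun ε ↦ (LinearEquiv.congrRight ε).trans
    ((LinearMap.liftBaseChangeEquiv (Localization.AtPrime p)).restrictScalars R)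

lemma IsInjectiveHull.nontrivial_linearMap [Module.Finite R D] (hD : Module.annihilator R D = ⊥)
    (hE : IsInjectiveHull R (R ⧸ p) E) : Nontrivial (D →ₗ[R] E) := by
  obtain ⟨hE, ι, hι, -⟩ := hE
  have hp : (⟨p, ‹_›⟩ : PrimeSpectrum R) ∈ Module.support R D := by
    simp [Module.support_eq_zeroLocus, hD]
  obtain ⟨v, hv⟩ := Module.mem_support_iff_exists_annihilator.1 hp
  obtain ⟨ψ, hψ⟩ := hE.exists_extension_of_ker_le (LinearMap.toSpanSingleton R D v)
    (ι ∘ₗ Submodule.mkQ p) (fun r hr ↦ by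
      have : r ∈ p := hv ((Submodule.mem_annihilator_span_singleton _ _).2 (by simpa using hr))
      simp [Ideal.Quotient.eq_zero_iff_mem.2 this])
  refine nontrivial_of_ne ψ 0 fun h ↦ ?_
  have := hψ 1
  rw [h, LinearMap.zero_apply] at this
  have h1 : Ideal.Quotient.mk p 1 = 0 := hι (by rw [map_zero]; exact this.symm)
  exact (Ideal.ne_top_iff_one p).1 ‹p.IsPrime›.ne_top (Ideal.Quotient.eq_zero_iff_mem.1 h1)

lemma IsSemidualizing.annihilator_eq_bot (hD : IsSemidualizing R D) :
    Module.annihilator R D = ⊥ := by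
  refine (Submodule.eq_bot_iff _).2 fun r hr ↦ hD.2.1.1 ?_
  ext d
  simpa using Module.mem_annihilator.1 hr d

end

section

open TensorProduct HomologicalComplex

variable {R : Type u} [CommRing R]

lemma subsingleton_ext_of_subsingleton_extM {M N : Type u} [AddCommGroup M] [Module R M]
    [AddCommGroup N] [Module R N] (n : ℕ) (h : Subsingleton (ExtM R (n + 1) M N)) :
    Subsingleton (Abelian.Ext (ModuleCat.of R M) (ModuleCat.of R N) (n + 1)) := by
  let P := ProjectiveResolution.of (ModuleCat.of R M)
  let K := P.complex.linearYonedaObj R (ModuleCat.of R N)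
  have e : ExtM R (n + 1) M N ≅ K.homology (n + 1) := P.isoExt (n + 1) _
  have hK : K.ExactAt (n + 1) := by
    rw [exactAt_iff_isZero_homology]
    exact (ModuleCat.isZero_of_subsingleton _).of_iso e.symm
  rw [K.exactAt_iff' n (n + 1) (n + 2) (by simp) (by simp),
    ShortComplex.ShortExact.moduleCat_exact_iff_function_exact] at hK
  refine subsingleton_of_forall_eq 0 fun x ↦ ?_
  obtain ⟨f, hf, rfl⟩ := P.extMk_surjective x (n + 2) rfl
  rw [P.extMk_eq_zero_iff _ _ _ _ n rfl]
  obtain ⟨g, hg⟩ := (hK f).1 hf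
  exact ⟨g, hg⟩

variable {M N : ModuleCat.{u} R}

lemma exists_extension_of_subsingleton_ext {S : ShortComplex (ModuleCat.{u} R)} (hS : S.ShortExact)
    (h : Subsingleton (Abelian.Ext S.X₃ N 1)) (φ : S.X₁ ⟶ N) : ∃ ψ : S.X₂ ⟶ N, S.f ≫ ψ = φ := by
  obtain ⟨x, hx⟩ := Abelian.Ext.contravariant_sequence_exact₁ hS N (Abelian.Ext.mk₀ φ)
    (add_zero 1) (Subsingleton.elim _ _)
  obtain ⟨ψ, rfl⟩ := (Abelian.Ext.mk₀_bijective _ _).2 x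
  rw [Abelian.Ext.mk₀_comp_mk₀] at hx
  exact ⟨ψ, (Abelian.Ext.mk₀_bijective _ _).1 hx⟩

lemma subsingleton_ext_kernel {S : ShortComplex (ModuleCat.{u} R)} (hS : S.ShortExact)
    [Projective S.X₂] {n : ℕ} (h : Subsingleton (Abelian.Ext S.X₃ N (n + 2))) :
    Subsingleton (Abelian.Ext S.X₁ N (n + 1)) := by
  refine subsingleton_of_forall_eq 0 fun x ↦ ?_
  obtain ⟨y, rfl⟩ := Abelian.Ext.contravariant_sequence_exact₁ hS N x (add_comm 1 (n + 1))
    (Subsingleton.elim _ _)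
  rw [Abelian.Ext.eq_zero_of_projective y, Abelian.Ext.comp_zero]

/-- Vanishing of `Ext` out of a finite module is inherited by localizations of the target. -/
lemma subsingleton_ext_of_isLocalizedModule [IsNoetherianRing R] (S : Submonoid R)
    {N N' : Type u} [AddCommGroup N] [Module R N] [AddCommGroup N'] [Module R N']
    (l : N →ₗ[R] N') [IsLocalizedModule S l] (M : ModuleCat.{u} R) [Module.Finite R M]
    (h : ∀ n, Subsingleton (Abelian.Ext M (ModuleCat.of R N) (n + 1))) (n : ℕ) :
    Subsingleton (Abelian.Ext M (ModuleCat.of R N') (n + 1)) := by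
  induction n generalizing M with
  | zero =>
    obtain ⟨P, _, _, _, _, f, hf⟩ := Module.exists_finite_presentation R M
    have hS := LinearMap.shortExact_shortComplexKer hf
    refine subsingleton_of_forall_eq 0 fun x ↦ ?_
    obtain ⟨y, rfl⟩ := Abelian.Ext.contravariant_sequence_exact₃ hS _ x
      (Abelian.Ext.eq_zero_of_projective _) (add_zero 1)
    obtain ⟨φ, rfl⟩ := (Abelian.Ext.mk₀_bijective _ _).2 y
    have : Module.FinitePresentation R (LinearMap.ker f) :=
      Module.finitePresentation_of_finite R _
    obtain ⟨φ', s, hφ'⟩ := Module.FinitePresentation.exists_lift_of_isLocalizedModule S l φ.hom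
    obtain ⟨ψ, hψ⟩ := exists_extension_of_subsingleton_ext hS (h 0) (ModuleCat.ofHom φ')
    obtain ⟨u, hu⟩ := (Module.End.isUnit_iff _).1 (IsLocalizedModule.map_units l s)
    let e := LinearEquiv.ofBijective (algebraMap R (Module.End R N') s) ⟨u, hu⟩
    have : φ = (ModuleCat.ofHom (LinearMap.ker f).subtype) ≫
        ModuleCat.ofHom (e.symm.toLinearMap ∘ₗ l ∘ₗ ψ.hom) := by
      ext k
      refine e.injective ?_
      have h₁ := LinearMap.congr_fun hφ' k
      have h₂ := LinearMap.congr_fun (congrArg ModuleCat.Hom.hom hψ) k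
      refine h₁.symm.trans ((congrArg l h₂).symm.trans ?_)
      exact (e.apply_symm_apply _).symm
    rw [this, ← Abelian.Ext.mk₀_comp_mk₀, hS.extClass_comp_assoc]
  | succ n ih =>
    obtain ⟨P, _, _, _, _, f, hf⟩ := Module.exists_finite_presentation R M
    have hS := LinearMap.shortExact_shortComplexKer hf
    have := ih (ModuleCat.of R (LinearMap.ker f)) fun n ↦ subsingleton_ext_kernel hS (h (n + 1))
    refine subsingleton_of_forall_eq 0 fun x ↦ ?_
    obtain ⟨y, rfl⟩ := Abelian.Ext.contravariant_sequence_exact₃ hS _ x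
      (Abelian.Ext.eq_zero_of_projective _) (add_comm 1 (n + 1))
    rw [Subsingleton.elim y 0, Abelian.Ext.comp_zero]

end

section

open scoped Pointwise
open TensorProduct

variable {R A : Type u} [CommRing R] [CommRing A] [Algebra R A] {D N : Type u} [AddCommGroup D]
  [Module R D] [AddCommGroup N] [Module R N] [Module A N] [IsScalarTower R A N]

variable (R N) in
/-- The complex `N ⟶ N ⟶ N ⧸ x N` of `R`-modules, for `x` in an `R`-algebra acting on `N`. -/
def quotSMulTopShortComplex (x : A) : ShortComplex (ModuleCat.{u} R) where
  X₁ := ModuleCat.of R N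
  X₂ := ModuleCat.of R N
  X₃ := ModuleCat.of R (QuotSMulTop x N)
  f := ModuleCat.ofHom (Module.toModuleEnd R (S := A) N x)
  g := ModuleCat.ofHom ((Submodule.mkQ (x • ⊤ : Submodule A N)).restrictScalars R)
  zero := by
    ext n
    exact (Submodule.Quotient.mk_eq_zero _).2 (Submodule.smul_mem_pointwise_smul n x _ trivial)

lemma quotSMulTopShortComplex_shortExact {x : A} (hx : IsSMulRegular N x) :
    (quotSMulTopShortComplex R N x).ShortExact where
  exact := by
    refine (ShortComplex.ShortExact.moduleCat_exact_iff_function_exact _).2 fun (n : N) ↦ ?_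
    have h : n ∈ x • (⊤ : Submodule A N) ↔ ∃ m : N, x • m = n := by
      simp [Submodule.mem_smul_pointwise_iff_exists]
    exact (Submodule.Quotient.mk_eq_zero _).trans h
  mono_f := (ModuleCat.mono_iff_injective _).2 hx
  epi_g := (ModuleCat.epi_iff_surjective _).2 (Submodule.mkQ_surjective (x • ⊤ : Submodule A N))

lemma subsingleton_ext_quotSMulTop {x : A} (hx : IsSMulRegular N x) (M : ModuleCat.{u} R)
    (h : ∀ n, Subsingleton (Abelian.Ext M (ModuleCat.of R N) (n + 1))) (n : ℕ) :
    Subsingleton (Abelian.Ext M (ModuleCat.of R (QuotSMulTop x N)) (n + 1)) := by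
  refine subsingleton_of_forall_eq 0 fun y ↦ ?_
  have h₁ : Subsingleton (Abelian.Ext M (quotSMulTopShortComplex R N x).X₁ (n + 1 + 1)) := h (n + 1)
  have h₂ : Subsingleton (Abelian.Ext M (quotSMulTopShortComplex R N x).X₂ (n + 1)) := h n
  obtain ⟨z, rfl⟩ := Abelian.Ext.covariant_sequence_exact₃ M
    (quotSMulTopShortComplex_shortExact (R := R) hx) y rfl
    (Subsingleton.elim _ _)
  rw [Subsingleton.elim z 0, Abelian.Ext.zero_comp]
  rfl

/-- If `x` is regular on `N` and `Ext¹(D, N) = 0`, then `Hom(D, -)` commutes with the quotient by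
`x`. -/
lemma nonempty_quotSMulTop_linearMap_equiv {x : A} (hx : IsSMulRegular N x)
    (h : Subsingleton (Abelian.Ext (ModuleCat.of R D) (ModuleCat.of R N) 1)) :
    Nonempty (QuotSMulTop x (D →ₗ[R] N) ≃ₗ[A] (D →ₗ[R] QuotSMulTop x N)) := by
  let q : N →ₗ[R] QuotSMulTop x N := (Submodule.mkQ (x • ⊤ : Submodule A N)).restrictScalars R
  let Φ : (D →ₗ[R] N) →ₗ[A] (D →ₗ[R] QuotSMulTop x N) :=
    { toFun φ := q ∘ₗ φ
      map_add' _ _ := by ext; simp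
      map_smul' a φ := by ext; simp [q] }
  have hΦ : Function.Surjective Φ := by
    intro φ
    obtain ⟨z, hz⟩ := Abelian.Ext.covariant_sequence_exact₃ (ModuleCat.of R D)
      (quotSMulTopShortComplex_shortExact (R := R) hx) (Abelian.Ext.mk₀ (ModuleCat.ofHom φ))
      (zero_add 1)
      (Subsingleton.elim (α := Abelian.Ext (ModuleCat.of R D) (ModuleCat.of R N) 1) _ _)
    obtain ⟨ψ, rfl⟩ := (Abelian.Ext.mk₀_bijective _ _).2 z
    rw [Abelian.Ext.mk₀_comp_mk₀] at hz
    exact ⟨ψ.hom, congrArg ModuleCat.Hom.hom ((Abelian.Ext.mk₀_bijective _ _).1 hz)⟩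
  have hker : LinearMap.ker Φ = x • ⊤ := by
    ext φ
    rw [Submodule.mem_smul_pointwise_iff_exists]
    constructor
    · intro hφ
      have (d : D) : φ d ∈ LinearMap.range (Module.toModuleEnd R (S := A) N x) := by
        have := LinearMap.congr_fun hφ d
        obtain ⟨n, -, hn⟩ := (Submodule.mem_smul_pointwise_iff_exists _ _ _).1
          ((Submodule.Quotient.mk_eq_zero _).1 this)
        exact ⟨n, hn⟩
      let e := LinearEquiv.ofInjective (Module.toModuleEnd R (S := A) N x) hx
      refine ⟨e.symm.toLinearMap ∘ₗ φ.codRestrict _ this, trivial, LinearMap.ext fun d ↦ ?_⟩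
      exact congrArg Subtype.val (e.apply_symm_apply ⟨φ d, this d⟩)
    · rintro ⟨ψ, -, rfl⟩
      refine LinearMap.ext fun d ↦ (Submodule.Quotient.mk_eq_zero _).2 ?_
      exact Submodule.smul_mem_pointwise_smul (ψ d) x _ trivial
  exact ⟨(Submodule.quotEquivOfEq _ _ hker.symm).trans (Φ.quotKerEquivOfSurjective hΦ)⟩

/-- Regular sequences on `Hom(D, N)` are regular on `N`, if `Ext(D, N)` vanishes in positive
degrees and `D` has full support. -/
lemma isWeaklyRegular_of_linearMap [IsNoetherianRing A] [Module.Finite R D] [Module.Finite A N]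
    (hD : Module.annihilator A (A ⊗[R] D) = ⊥) (xs : List A)
    (h : ∀ n, Subsingleton (Abelian.Ext (ModuleCat.of R D) (ModuleCat.of R N) (n + 1)))
    (hxs : RingTheory.Sequence.IsWeaklyRegular (D →ₗ[R] N) xs) :
    RingTheory.Sequence.IsWeaklyRegular N xs := by
  induction xs generalizing N with
  | nil => exact .nil A N
  | cons x xs ih =>
    rw [RingTheory.Sequence.isWeaklyRegular_cons_iff] at hxs ⊢
    have hx : IsSMulRegular N x := by
      rw [isSMulRegular_iff_torsionBy_eq_bot]
      have : Subsingleton (A ⊗[R] D →ₗ[A] Submodule.torsionBy A N x) := by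
        refine subsingleton_of_forall_eq 0 fun φ ↦ ?_
        have h₀ : (LinearMap.liftBaseChangeEquiv A).symm (Submodule.subtype _ ∘ₗ φ) = 0 :=
          hxs.1.right_eq_zero_of_smul (LinearMap.ext fun d ↦
            (Submodule.mem_torsionBy_iff _ _).1 (φ (1 ⊗ₜ d)).2)
        rw [LinearEquiv.map_eq_zero_iff] at h₀
        exact LinearMap.ext fun d ↦ Subtype.ext (LinearMap.congr_fun h₀ d)
      obtain ⟨r, hr, hr'⟩ := IsSMulRegular.subsingleton_linearMap_iff.1 this
      rw [hD, Submodule.mem_bot] at hr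
      subst hr
      exact Submodule.subsingleton_iff_eq_bot.1 hr'.subsingleton
    obtain ⟨e⟩ := nonempty_quotSMulTop_linearMap_equiv hx (h 0)
    exact ⟨hx, ih (subsingleton_ext_quotSMulTop hx _ h) ((e.isWeaklyRegular_congr xs).1 hxs.2)⟩

end

section

open TensorProduct

variable {R : Type u} [CommRing R] {A : Type u} [CommRing A] [Algebra R A]
  {D : Type u} [AddCommGroup D] [Module R D]

lemma IsSemidualizing.nonempty_linearEquiv_end [IsNoetherianRing R] (S : Submonoid R)
    [IsLocalization S A] (hD : IsSemidualizing R D) :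
    Nonempty (A ≃ₗ[A] (A ⊗[R] D →ₗ[A] A ⊗[R] D)) := by
  have : Module.Finite R D := hD.1
  have : Module.FinitePresentation R D := Module.finitePresentation_of_finite R D
  let l : D →ₗ[R] A ⊗[R] D := TensorProduct.mk R A D 1
  let H : R ≃ₗ[R] (D →ₗ[R] D) := LinearEquiv.ofBijective
    (LinearMap.toSpanSingleton R (D →ₗ[R] D) LinearMap.id) hD.2.1
  have : IsLocalizedModule S (IsLocalizedModule.mapExtendScalars S l l A ∘ₗ H.toLinearMap) :=
    IsLocalizedModule.of_linearEquiv_right _ _ _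
  exact ⟨(IsLocalizedModule.linearEquiv S (Algebra.linearMap R A)
    (IsLocalizedModule.mapExtendScalars S l l A ∘ₗ H.toLinearMap)).extendScalarsOfIsLocalization
      S A⟩

lemma IsSemidualizing.isWeaklyRegular_tensorProduct [IsNoetherianRing R] (S : Submonoid R)
    [IsLocalization S A] (hD : IsSemidualizing R D) (xs : List A)
    (hxs : RingTheory.Sequence.IsWeaklyRegular A xs) :
    RingTheory.Sequence.IsWeaklyRegular (A ⊗[R] D) xs := by
  have : Module.Finite R D := hD.1
  have : IsNoetherianRing A := IsLocalization.isNoetherianRing S A inferInstance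
  obtain ⟨e⟩ := hD.nonempty_linearEquiv_end S (A := A)
  refine isWeaklyRegular_of_linearMap (R := R) (D := D) ?_ xs ?_ ?_
  · refine (Submodule.eq_bot_iff _).2 fun r hr ↦ ?_
    have h : e (r • 1) = 0 := by
      rw [map_smul]
      exact LinearMap.ext fun z ↦ Module.mem_annihilator.1 hr _
    simpa using h
  · exact subsingleton_ext_of_isLocalizedModule S (TensorProduct.mk R A D 1) (ModuleCat.of R D)
      fun n ↦ subsingleton_ext_of_subsingleton_extM n (hD.2.2 (n + 1) (by lia))
  · exact ((e.trans (LinearMap.liftBaseChangeEquiv A).symm).isWeaklyRegular_congr xs).1 hxs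

/-- `Tor` only depends on the isomorphism class of the first argument. -/
lemma subsingleton_torM_congr {M N G : Type u} [AddCommGroup M] [Module R M] [AddCommGroup N]
    [Module R N] [AddCommGroup G] [Module R G] (e : M ≃ₗ[R] N) (i : ℕ) :
    Subsingleton (TorM R i M G) ↔ Subsingleton (TorM R i N G) :=
  (((Tor (ModuleCat.{u} R) i).mapIso e.toModuleIso).app
    (ModuleCat.of R G)).toLinearEquiv.toEquiv.subsingleton_congr

/-- A local noetherian ring whose depth is its dimension has a regular sequence of that length,
and the quotient by it is artinian. -/
lemma exists_isRegular_of_localRingDepth_eq (B : Type u) [CommRing B] [IsLocalRing B]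
    [IsNoetherianRing B] (h : (localRingDepth B : WithBot ℕ∞) = ringKrullDim B) :
    ∃ xs : List B, (∀ x ∈ xs, x ∈ IsLocalRing.maximalIdeal B) ∧
      RingTheory.Sequence.IsRegular B xs ∧ (xs.length : WithBot ℕ∞) = ringKrullDim B ∧
      IsArtinianRing (B ⧸ Ideal.ofList xs) := by
  have hfin : localRingDepth B < ⊤ := by
    have := ringKrullDim_lt_top (R := B)
    rw [← h] at this
    exact WithBot.coe_lt_coe.1 this
  have : Nonempty {n : ℕ∞ | ∃ rs : List B, (∀ r ∈ rs, r ∈ IsLocalRing.maximalIdeal B) ∧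
      RingTheory.Sequence.IsRegular B rs ∧ (rs.length : ℕ∞) = n} :=
    ⟨0, [], by simp, .nil B B, rfl⟩
  obtain ⟨xs, hxs, hreg, hlen⟩ := ENat.sSup_mem_of_nonempty_of_lt_top hfin
  have hlen' : (xs.length : WithBot ℕ∞) = ringKrullDim B := by
    rw [← h]
    exact congrArg _ hlen
  refine ⟨xs, hxs, hreg, hlen', ?_⟩
  have hdim := ringKrullDim_add_length_eq_ringKrullDim_of_isRegular xs hreg
  have hdim' : ringKrullDim (B ⧸ Ideal.ofList xs) = 0 :=
    ENat.WithBot.add_natCast_cancel.1 (hdim.trans (hlen'.symm.trans (zero_add _).symm))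
  rw [isArtinianRing_iff_krullDimLE_zero, Ring.krullDimLE_iff]
  exact hdim'.le

end

section

open TensorProduct

/-- The derived tensor product of a Gorenstein injective module with the residue field at `p`
vanishes exactly when `Tor` in degree `ht p` against `Hom(D, E(R ⧸ p))` does. -/
lemma subsingleton_torM_residueField_iff {R : Type u} [CommRing R] [IsNoetherianRing R]
    (hCM : IsCohenMacaulayRing R) {D : Type u} [AddCommGroup D] [Module R D]
    (hD : IsDualizing R D) (p : PrimeSpectrum R) {E : Type u} [AddCommGroup E] [Module R E]
    (hE : IsInjectiveHull R (R ⧸ p.asIdeal) E)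
    {G : Type u} [AddCommGroup G] [Module R G] (hG : GorensteinInjective R G) :
    ∃ d : ℕ, (d : ℕ∞) = Order.height p ∧
      ((∀ i, Subsingleton
        (TorM R i (IsLocalRing.ResidueField (Localization.AtPrime p.asIdeal)) G)) ↔
        Subsingleton (TorM R d (D →ₗ[R] E) G)) := by
  let A := Localization.AtPrime p.asIdeal
  let S := p.asIdeal.primeCompl
  have : Module.Finite R D := hD.1.1
  have : IsNoetherianRing A := IsLocalization.isNoetherianRing S A inferInstance
  have : Module.Flat R A := IsLocalization.flat A S
  obtain ⟨xs, hxs, hreg, hlen, hart⟩ := exists_isRegular_of_localRingDepth_eq A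
    (hCM p.asIdeal p.isPrime)
  have hweak := hreg.toIsWeaklyRegular
  refine ⟨xs.length, ?_, ?_⟩
  · rw [IsLocalization.AtPrime.ringKrullDim_eq_height p.asIdeal A,
      PrimeSpectrum.height_eq_orderHeight] at hlen
    exact WithBot.coe_injective hlen
  obtain ⟨n, hn⟩ := hD.2
  obtain ⟨F, ε, h, hF⟩ := exists_isFlatResolution_baseChange (R := R) A G
  have hEA : Module.Injective A (A ⊗[R] E) := Module.Injective.tensorProduct S hE.1
  obtain ⟨F', ε', h', hF'⟩ := exists_isFlatResolution_linearMap hEA n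
    (ModuleCat.of A (A ⊗[R] D)) (InjDimLE.tensorProduct S hn)
  obtain ⟨e⟩ := IsInjectiveHull.nonempty_linearMap_equiv D hE
  have hnt : Nontrivial (D →ₗ[R] E) :=
    IsInjectiveHull.nontrivial_linearMap D (IsSemidualizing.annihilator_eq_bot D hD.1) hE
  obtain ⟨et⟩ := h'.nonempty_H_zero_self
  obtain ⟨eg⟩ := h.nonempty_H_zero_self
  have key := DeltaFunctor.subsingleton_residueField_iff xs hweak hxs hart
    (ModuleCat.of A (A ⊗[R] D →ₗ[A] A ⊗[R] E))
    (IsCoregular.linearMap xs _ _ hEA (hD.1.isWeaklyRegular_tensorProduct S xs hweak))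
    (fun x hx ↦ IsPowTorsion.linearMap (hE.isPowTorsion (hxs x hx)))
    e.symm.toEquiv.nontrivial h'.deltaFunctor et (fun i hi ↦ h'.subsingleton_H_self i hi) n
    (fun i hi ↦ h'.subsingleton_H i (hF' i hi) _)
    (ModuleCat.of A (A ⊗[R] G)) (hG.isCoregular S xs hweak) h.deltaFunctor eg
    (fun i hi ↦ h.subsingleton_H_self i hi)
  rw [subsingleton_torM_congr (N := A ⊗[R] D →ₗ[A] A ⊗[R] E) e, hF, ← key]
  have : IsScalarTower R A (IsLocalRing.ResidueField A) :=
    inferInstanceAs (IsScalarTower R (Localization.AtPrime p.asIdeal)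
      (IsLocalRing.ResidueField (Localization.AtPrime p.asIdeal)))
  exact forall_congr' fun i ↦ hF i (IsLocalRing.ResidueField A)

end

/-- Over a Cohen-Macaulay noetherian ring with dualizing module `D`, for a
Gorenstein injective module `G` the small support of `G` is
`{p | G_(p) ≠ 0}`, where `G_(p) := Tor_{ht p}^R(Hom_R(D, E_R(R/p)), G)`. -/
theorem statement16 (R : Type u) [CommRing R] [IsNoetherianRing R]
    (hCM : IsCohenMacaulayRing R)
    (D : Type u) [AddCommGroup D] [Module R D] (hD : IsDualizing R D)
    (E : PrimeSpectrum R → Type u) [∀ p, AddCommGroup (E p)] [∀ p, Module R (E p)]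
    (hE : ∀ p : PrimeSpectrum R, IsInjectiveHull R (R ⧸ p.asIdeal) (E p))
    (G : Type u) [AddCommGroup G] [Module R G] (hG : GorensteinInjective R G) :
    smallSupport R G =
      {p : PrimeSpectrum R | ∃ k : ℕ, (k : ℕ∞) = Order.height p ∧
        Nontrivial (TorM R k (D →ₗ[R] E p) G)} := by
  ext p
  obtain ⟨d, hd, h⟩ := subsingleton_torM_residueField_iff hCM hD p (hE p) hG
  simp only [smallSupport, Set.mem_ofPred_eq, ← not_subsingleton_iff_nontrivial, ← not_forall, h,
    ← hd, Nat.cast_inj, exists_eq_left]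
end

section
/- Let R be a Cohen-Macaulay commutative noetherian ring with a dualizing module D, and assume R is generically Gorenstein (i.e., R_p is Gorenstein for every minimal prime p of R). If G and H are Gorenstein injective R-modules, then G ⊗_R H is Gorenstein injective. -/
/-!
Common definitions: property t(p), injective hulls, (C-)Gorenstein injective modules,
(C-)Gorenstein injective / injective / flat dimensions, small support, torsion functor,
Tor and Ext modules, semidualizing and dualizing modules, depth, Cohen-Macaulay rings,
Serre's condition (S₁), Gorenstein local rings, minimal injective resolutions.
-/

universe u

open CategoryTheory Limits DirectSum

/-- An element of an injective module annihilated by `ann x` is the image of `x` under some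
linear map. -/
lemma Module.Injective.exists_apply_eq {R : Type u} [CommRing R] {E : Type u} [AddCommGroup E]
    [Module R E] (hE : Module.Injective R E) {N : Type u} [AddCommGroup N] [Module R N]
    (x : N) (y : E) (h : ∀ a : R, a • x = 0 → a • y = 0) :
    ∃ f : N →ₗ[R] E, f x = y := by
  let t := LinearMap.toSpanSingleton R N x
  have hker : LinearMap.ker t ≤ LinearMap.ker (LinearMap.toSpanSingleton R E y) := fun a ha ↦ by
    simpa using h a (by simpa [t] using ha)
  obtain ⟨f, hf⟩ := hE.out ((LinearMap.ker t).liftQ t le_rfl)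
    (LinearMap.ker_eq_bot.mp (Submodule.ker_liftQ_eq_bot' _ _ rfl))
    ((LinearMap.ker t).liftQ _ hker)
  refine ⟨f, ?_⟩
  have h1 := hf ((LinearMap.ker t).mkQ 1)
  rwa [← LinearMap.comp_apply ((LinearMap.ker t).liftQ _ _), Submodule.liftQ_mkQ,
    ← LinearMap.comp_apply ((LinearMap.ker t).liftQ _ hker), Submodule.liftQ_mkQ,
    LinearMap.toSpanSingleton_apply, LinearMap.toSpanSingleton_apply, one_smul, one_smul] at h1

lemma Module.Injective.smul_surjective {R : Type u} [CommRing R] {E : Type u} [AddCommGroup E]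
    [Module R E] (hE : Module.Injective R E) {s : R} (hs : s ∈ nonZeroDivisors R) :
    Function.Surjective fun y : E ↦ s • y := by
  intro y
  obtain ⟨f, hf⟩ := hE.exists_apply_eq s y fun a ha ↦ by
    rw [(mem_nonZeroDivisors_iff_right.mp hs) a ha, zero_smul]
  exact ⟨f 1, by rw [← hf]; simp [← map_smul]⟩

/-- Over a local ring whose maximal ideal is the annihilator of an element and in which every
nonzero cyclic module has a nonzero socle, the kernel of a surjection of injective modules is
injective. -/
lemma Module.Injective.of_injective_quotient {A : Type u} [CommRing A] [IsLocalRing A]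
    [IsNoetherianRing A] (σ : A) (hσ : ∀ a ∈ IsLocalRing.maximalIdeal A, a * σ = 0)
    (hσ' : ∀ a, a * σ = 0 → a ∈ IsLocalRing.maximalIdeal A)
    (hsoc : ∀ J : Ideal A, J ≠ ⊤ → ∃ x ∉ J, ∀ a ∈ IsLocalRing.maximalIdeal A, a * x ∈ J)
    {M I : Type u} [AddCommGroup M] [Module A M] [AddCommGroup I] [Module A I]
    (ι : M →ₗ[A] I) (hι : Function.Injective ι) (hI : Module.Injective A I)
    (hQ : Module.Injective A (I ⧸ LinearMap.range ι)) : Module.Injective A M := by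
  have key : ∀ (J : Ideal A) (e : I), (∀ j ∈ J, j • e ∈ LinearMap.range ι) →
      ∃ y ∈ LinearMap.range ι, ∀ j ∈ J, j • e = j • y := by
    intro J
    induction J using IsNoetherian.induction with
    | hgt J ih =>
    intro e he
    by_cases hJ : J = ⊤
    · exact ⟨e, by simpa using he 1 (by simp [hJ]), fun _ _ ↦ rfl⟩
    obtain ⟨x, hxJ, hx⟩ := hsoc J hJ
    obtain ⟨w, hw⟩ := hQ.exists_apply_eq σ ((LinearMap.range ι).mkQ (x • e)) fun a ha ↦ by
      rw [← map_smul, smul_smul, Submodule.mkQ_apply, Submodule.Quotient.mk_eq_zero]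
      exact he _ (hx a (hσ' a ha))
    obtain ⟨e', he'⟩ := Submodule.mkQ_surjective _ (w 1)
    have hmem : x • e - σ • e' ∈ LinearMap.range ι := by
      rw [← Submodule.Quotient.mk_eq_zero, ← Submodule.mkQ_apply, map_sub, map_smul _ σ e', he',
        ← map_smul, smul_eq_mul, mul_one, hw, sub_self]
    obtain ⟨v, hv⟩ := hI.exists_apply_eq (J.mkQ x) (σ • e') fun a ha ↦ by
      rw [← map_smul, Submodule.mkQ_apply, Submodule.Quotient.mk_eq_zero, smul_eq_mul] at ha
      rw [smul_smul, hσ, zero_smul]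
      by_contra hau
      rw [IsLocalRing.mem_maximalIdeal, mem_nonunits_iff, not_not] at hau
      exact hxJ ((Ideal.unit_mul_mem_iff_mem J hau).mp ha)
    have hv' (a : A) : a • v (J.mkQ 1) = v (J.mkQ a) := by
      rw [← map_smul, ← map_smul, smul_eq_mul, mul_one]
    have hvJ (j : A) (hj : j ∈ J) : j • v (J.mkQ 1) = 0 := by
      rw [hv', Submodule.mkQ_apply, (Submodule.Quotient.mk_eq_zero _).mpr hj, map_zero]
    obtain ⟨y, hy, hjy⟩ := ih (J ⊔ Ideal.span {x})
      (left_lt_sup.mpr fun hle ↦ hxJ (hle (Ideal.mem_span_singleton_self x)))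
      (e - v (J.mkQ 1)) (by
        suffices J ⊔ Ideal.span {x} ≤ (LinearMap.range ι).comap
            (LinearMap.toSpanSingleton A I (e - v (J.mkQ 1))) from fun j hj ↦ by
          simpa using this hj
        refine sup_le (fun j hj ↦ ?_) ((Ideal.span_singleton_le_iff_mem _).mpr ?_)
        · simpa only [Submodule.mem_comap, LinearMap.toSpanSingleton_apply, smul_sub, hvJ j hj,
            sub_zero] using he j hj
        · simpa only [Submodule.mem_comap, LinearMap.toSpanSingleton_apply, smul_sub, hv', hv]
            using hmem)
    refine ⟨y, hy, fun j hj ↦ ?_⟩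
    rw [← hjy j (Ideal.mem_sup_left hj), smul_sub, hvJ j hj, sub_zero]
  refine Module.Baer.injective fun J f ↦ ?_
  obtain ⟨g, hg⟩ := hI.out J.subtype J.injective_subtype (ι ∘ₗ f)
  have hg' (j : A) (hj : j ∈ J) : j • g 1 = ι (f ⟨j, hj⟩) := by
    rw [← map_smul, smul_eq_mul, mul_one]
    exact hg ⟨j, hj⟩
  obtain ⟨_, ⟨y, rfl⟩, hy⟩ := key J (g 1) fun j hj ↦ ⟨_, (hg' j hj).symm⟩
  refine ⟨LinearMap.toSpanSingleton A M y, fun j hj ↦ hι ?_⟩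
  rw [← hg' j hj, hy j hj, LinearMap.toSpanSingleton_apply, map_smul]

/-- Over a zero-dimensional noetherian local ring, modules of finite injective dimension are
injective. -/
lemma InjDimLE.injective {A : Type u} [CommRing A] [IsLocalRing A] [IsNoetherianRing A]
    [Ring.KrullDimLE 0 A] (n : ℕ) (M : ModuleCat.{u} A) (h : InjDimLE A n M) :
    Module.Injective A M := by
  have hass (N : Type u) [AddCommGroup N] [Module A N] [Nontrivial N] :
      ∃ x : N, IsLocalRing.maximalIdeal A = Submodule.colon ⊥ {x} := by
    obtain ⟨p, hp⟩ := associatedPrimes.nonempty A N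
    obtain ⟨hp, x, hx⟩ := isAssociatedPrime_iff.mp hp
    exact ⟨x, by rw [← hx, Ring.KrullDimLE.eq_maximalIdeal_of_isPrime p]⟩
  obtain ⟨σ, hσ⟩ := hass A
  have hσ' (a : A) : a ∈ IsLocalRing.maximalIdeal A ↔ a * σ = 0 := by
    simp only [hσ, Submodule.mem_colon_singleton, smul_eq_mul, Submodule.mem_bot]
  have hsoc (J : Ideal A) (hJ : J ≠ ⊤) :
      ∃ x ∉ J, ∀ a ∈ IsLocalRing.maximalIdeal A, a * x ∈ J := by
    have := Submodule.Quotient.nontrivial_iff.mpr hJ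
    obtain ⟨x, hx⟩ := hass (A ⧸ J)
    obtain ⟨x, rfl⟩ := J.mkQ_surjective x
    have hx' (a : A) : a ∈ IsLocalRing.maximalIdeal A ↔ a * x ∈ J := by
      rw [hx, Submodule.mem_colon_singleton, ← map_smul, Submodule.mem_bot, Submodule.mkQ_apply,
        Submodule.Quotient.mk_eq_zero, smul_eq_mul]
    exact ⟨x, fun hxJ ↦ (Ideal.ne_top_iff_one _).mp (IsLocalRing.maximalIdeal.isMaximal A).ne_top
      ((hx' 1).mpr (by rwa [one_mul])), fun a ↦ (hx' a).mp⟩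
  induction n generalizing M with
  | zero => exact h
  | succ n ih =>
    obtain ⟨I, hI, ι, hι, hQ⟩ := h
    exact Module.Injective.of_injective_quotient σ (fun a ↦ (hσ' a).mp) (fun a ↦ (hσ' a).mpr) hsoc
      ι hι hI (ih _ hQ)

/-- Modules over a localization which are injective are injective over the base ring. -/
lemma Module.Injective.of_isLocalization {R : Type u} [CommRing R] (S : Submonoid R) {A : Type u}
    [CommRing A] [Algebra R A] [IsLocalization S A] {M : Type u} [AddCommGroup M] [Module R M]
    [Module A M] [IsScalarTower R A M] (hM : Module.Injective A M) : Module.Injective R M := by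
  refine Module.Baer.injective fun I f ↦ ?_
  have hu (s : S) : IsUnit (algebraMap R (Module.End R M) s) :=
    (Algebra.lsmul R R M : A →ₐ[R] Module.End R M).commutes (s : R) ▸
      (IsLocalization.map_units A s).map (Algebra.lsmul R R M)
  let f' := (IsLocalizedModule.lift S (Algebra.idealMap A I) f hu).extendScalarsOfIsLocalization S A
  have hf' (x : I) : f' (Algebra.idealMap A I x) = f x :=
    LinearMap.congr_fun (IsLocalizedModule.lift_comp S (Algebra.idealMap A I) f hu) x
  obtain ⟨g, hg⟩ := hM.out (Submodule.subtype _) (Submodule.subtype_injective _) f'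
  refine ⟨LinearMap.toSpanSingleton R M (g 1), fun x hx ↦ ?_⟩
  have := hg (Algebra.idealMap A I ⟨x, hx⟩)
  rw [hf'] at this
  rw [← this, LinearMap.toSpanSingleton_apply, ← algebraMap_smul A, ← map_smul, smul_eq_mul,
    mul_one]
  rfl

/-- Over a noetherian ring, functions of finite support into an injective module form an
injective module. -/
lemma Module.Injective.finsupp {R : Type u} [CommRing R] [IsNoetherianRing R] {E : Type u}
    [AddCommGroup E] [Module R E] (hE : Module.Injective R E) (X : Type u) :
    Module.Injective R (X →₀ E) := by
  classical
  refine Module.Baer.injective fun I f ↦ ?_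
  obtain ⟨F, hF⟩ : ∃ F : Finset X, ∀ x : I, (f x).support ⊆ F := by
    obtain ⟨s, hs⟩ := Module.Finite.fg_top (R := R) (M := I)
    refine ⟨s.biUnion fun x ↦ (f x).support, fun x ↦ ?_⟩
    suffices (⊤ : Submodule R I) ≤ (Finsupp.supported E R
        (↑(s.biUnion fun x ↦ (f x).support) : Set X)).comap f from
      Finset.coe_subset.mp (this (Submodule.mem_top (x := x)))
    rw [← hs, Submodule.span_le]
    intro y hy
    simp only [Submodule.comap_coe, Set.mem_preimage, SetLike.mem_coe, Finsupp.mem_supported,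
      Finset.coe_subset]
    exact Finset.subset_biUnion_of_mem (fun x ↦ (f x).support) hy
  choose g hg using fun x ↦ Module.Baer.of_injective hE I (Finsupp.lapply x ∘ₗ f)
  refine ⟨∑ x ∈ F, Finsupp.lsingle x ∘ₗ g x, fun i hi ↦ ?_⟩
  conv_rhs => rw [← Finsupp.sum_single (f ⟨i, hi⟩)]
  rw [Finsupp.sum_of_support_subset _ (hF ⟨i, hi⟩) _ (by simp), LinearMap.sum_apply]
  exact Finset.sum_congr rfl fun x _ ↦ by simp [hg x i hi]

/-- The total ring of fractions of a noetherian ring is injective if the localizations at all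
associated primes are injective. -/
lemma Module.Injective.of_isFractionRing {R : Type u} [CommRing R] [IsNoetherianRing R]
    (K : Type u) [CommRing K] [Algebra R K] [IsFractionRing R K]
    (h : ∀ (p : Ideal R) [p.IsPrime], p ∈ associatedPrimes R R →
      Module.Injective R (Localization.AtPrime p)) : Module.Injective R K := by
  refine Module.Baer.injective fun I f ↦ ?_
  let c : Ideal R :=
    { carrier := {r | ∃ k : K, ∀ x : I, r • f x = (x : R) • k}
      add_mem' := fun {a b} ⟨k, hk⟩ ⟨l, hl⟩ ↦ ⟨k + l, fun x ↦ by
        rw [add_smul, hk, hl, smul_add]⟩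
      zero_mem' := ⟨0, by simp⟩
      smul_mem' := fun a r ⟨k, hk⟩ ↦ ⟨a • k, fun x ↦ by
        rw [smul_assoc, hk, smul_comm]⟩ }
  suffices ∃ s ∈ nonZeroDivisors R, s ∈ c by
    obtain ⟨s, hs, k, hk⟩ := this
    obtain ⟨k, rfl⟩ : ∃ l, s • l = k := by
      refine ⟨IsLocalization.mk' K 1 (⟨s, hs⟩ : nonZeroDivisors R) * k, ?_⟩
      rw [← smul_mul_assoc, IsLocalization.smul_mk', mul_one, IsLocalization.mk'_self,
        one_mul]
    refine ⟨LinearMap.toSpanSingleton R K k, fun x hx ↦ ?_⟩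
    have := hk ⟨x, hx⟩
    rw [smul_comm, Algebra.smul_def s, Algebra.smul_def s] at this
    exact ((IsLocalization.map_units K (⟨s, hs⟩ : nonZeroDivisors R)).mul_left_cancel this).symm
  by_contra! hc
  obtain ⟨p, hp, hcp⟩ := (c.subset_union_prime_finite (associatedPrimes.finite R R) (f := id) 0 0
    fun _ h _ _ ↦ h.1).1 (show (c : Set R) ⊆ _ by
      simp only [id]
      rw [biUnion_associatedPrimes_eq_compl_nonZeroDivisors]
      exact fun s hs hs' ↦ hc s hs' hs)
  have := hp.isPrime
  have hpS : nonZeroDivisors R ≤ p.primeCompl := fun s hs hsp ↦ by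
    have : s ∈ ⋃ p ∈ associatedPrimes R R, (p : Set R) := Set.mem_biUnion hp hsp
    rw [biUnion_associatedPrimes_eq_compl_nonZeroDivisors] at this
    exact this hs
  let A := Localization.AtPrime p
  let φ : K →+* A := IsLocalization.lift (M := nonZeroDivisors R) (g := algebraMap R A)
    fun s ↦ IsLocalization.map_units A (⟨s, hpS s.2⟩ : p.primeCompl)
  have hφ (r : R) : φ (algebraMap R K r) = algebraMap R A r := IsLocalization.lift_eq _ r
  let φ' : K →ₐ[R] A := { φ with commutes' := hφ }
  have hker (k : K) (hk : φ' k = 0) : ∃ u ∉ p, u • k = 0 := by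
    obtain ⟨a, s, rfl⟩ := IsLocalization.exists_mk'_eq (nonZeroDivisors R) k
    have ha : algebraMap R A a = 0 := by
      rw [← φ'.commutes, ← IsLocalization.mk'_spec K a s, map_mul, hk, zero_mul]
    obtain ⟨u, hu⟩ := (IsLocalization.map_eq_zero_iff p.primeCompl A a).mp ha
    exact ⟨u, u.2, by rw [IsLocalization.smul_mk', hu, IsLocalization.mk'_zero]⟩
  obtain ⟨g, hg⟩ := (h p hp).out I.subtype I.injective_subtype (φ'.toLinearMap ∘ₗ f)
  obtain ⟨b, t, hbt⟩ := IsLocalization.exists_mk'_eq p.primeCompl (g 1)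
  have htg : (t : R) • g 1 = algebraMap R A b := by
    rw [← hbt, Algebra.smul_def, IsLocalization.mk'_spec']
  let d : I →ₗ[R] K := (t : R) • f - LinearMap.toSpanSingleton R K (algebraMap R K b) ∘ₗ I.subtype
  have hd (x : I) : φ' (d x) = 0 := by
    have := hg x
    simp only [Submodule.subtype_apply, LinearMap.comp_apply, AlgHom.toLinearMap_apply] at this
    simp only [d, LinearMap.sub_apply, LinearMap.smul_apply, LinearMap.comp_apply,
      LinearMap.toSpanSingleton_apply, map_sub, map_smul, φ'.commutes, ← this, ← htg,
      Submodule.subtype_apply]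
    rw [smul_comm (x : R), ← map_smul g (x : R), smul_eq_mul, mul_one,
      sub_self]
  obtain ⟨u, hu, hud⟩ : ∃ u ∉ p, ∀ x, u • d x = 0 := by
    obtain ⟨s, hs⟩ := Module.Finite.fg_top (R := R) (M := I)
    choose u hu hud using fun x ↦ hker (d x) (hd x)
    refine ⟨∏ x ∈ s, u x, fun hmem ↦ ?_, fun x ↦ ?_⟩
    · obtain ⟨x, -, hx⟩ := (Ideal.IsPrime.prod_mem_iff (p := p)).mp hmem
      exact hu x hx
    · suffices (⊤ : Submodule R I) ≤ LinearMap.ker ((∏ x ∈ s, u x) • d) from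
        this (Submodule.mem_top (x := x))
      rw [← hs, Submodule.span_le]
      intro y hy
      obtain ⟨v, hv⟩ := Finset.dvd_prod_of_mem u hy
      rw [SetLike.mem_coe, LinearMap.mem_ker, LinearMap.smul_apply, hv, mul_comm, mul_smul, hud,
        smul_zero]
  have hutc : u * t ∈ c := ⟨u • algebraMap R K b, fun x ↦ by
    have := hud x
    simp only [d, LinearMap.sub_apply, LinearMap.smul_apply, LinearMap.comp_apply,
      LinearMap.toSpanSingleton_apply, Submodule.subtype_apply, smul_sub, sub_eq_zero] at this
    rw [mul_smul, this, smul_comm]⟩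
  exact (Ideal.IsPrime.mem_or_mem this (hcp hutc)).elim hu t.2

/-- In a Cohen-Macaulay noetherian ring, associated primes are minimal. -/
lemma IsCohenMacaulayRing.mem_minimalPrimes {R : Type u} [CommRing R] [IsNoetherianRing R]
    (h : IsCohenMacaulayRing R) {p : Ideal R} [p.IsPrime] (hp : p ∈ associatedPrimes R R) :
    p ∈ minimalPrimes R := by
  obtain ⟨-, x, hx⟩ := isAssociatedPrime_iff.mp hp
  have hx' (a : R) : a ∈ p ↔ a * x = 0 := by
    rw [hx, Submodule.mem_colon_singleton, Submodule.mem_bot, smul_eq_mul]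
  let A := Localization.AtPrime p
  have hx0 : algebraMap R A x ≠ 0 := fun h0 ↦ by
    obtain ⟨u, hu⟩ := (IsLocalization.map_eq_zero_iff p.primeCompl A x).mp h0
    exact u.2 ((hx' u).mpr hu)
  have hkill (a : A) (ha : a ∈ IsLocalRing.maximalIdeal A) : a * algebraMap R A x = 0 := by
    rw [← Localization.AtPrime.map_eq_maximalIdeal] at ha
    refine (Ideal.span_le (I := LinearMap.ker (LinearMap.mulRight A (algebraMap R A x)))).mpr ?_ ha
    rintro _ ⟨r, hr, rfl⟩
    rw [SetLike.mem_coe, LinearMap.mem_ker, LinearMap.mulRight_apply, ← map_mul, (hx' r).mp hr,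
      map_zero]
  have hdepth : localRingDepth A = 0 := by
    rw [localRingDepth, ← nonpos_iff_eq_zero]
    refine sSup_le ?_
    rintro _ ⟨rs, hrs, hreg, rfl⟩
    cases rs with
    | nil => simp
    | cons a rs =>
      exfalso
      have := ((RingTheory.Sequence.isRegular_cons_iff A a rs).mp hreg).1
      exact hx0 (this (by simpa using hkill a (hrs a (by simp))))
  have hdim := h p inferInstance
  rw [hdepth, IsLocalization.AtPrime.ringKrullDim_eq_height p] at hdim
  exact Ideal.height_eq_zero_iff.mp (by exact_mod_cast hdim.symm)

/-- An `R`-module on which every nonzerodivisor acts bijectively, i.e. a module over the total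
ring of fractions. -/
def RegularBijective (R : Type u) [CommRing R] (M : Type u) [AddCommGroup M] [Module R M] : Prop :=
  ∀ s ∈ nonZeroDivisors R, Function.Bijective fun x : M ↦ s • x

/-- A short exact sequence `0 → M → E → N → 0` with injective middle term exists. -/
def HasInjectiveExtension (R : Type u) [CommRing R] (M N : ModuleCat.{u} R) : Prop :=
  ∃ (E : ModuleCat.{u} R) (ι : M →ₗ[R] E) (π : E →ₗ[R] N), Module.Injective R E ∧
    Function.Injective ι ∧ Function.Surjective π ∧ LinearMap.range ι = LinearMap.ker π

lemma exists_hasInjectiveExtension {R : Type u} [CommRing R] (M : ModuleCat.{u} R) :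
    ∃ N, HasInjectiveExtension R M N := by
  obtain ⟨I, hI, f, hf⟩ := EnoughInjectives.presentation M
  exact ⟨ModuleCat.of R (I ⧸ LinearMap.range f.hom), I, f.hom, Submodule.mkQ _,
    Module.injective_module_of_injective_object R I, (ModuleCat.mono_iff_injective f).mp hf,
    Submodule.mkQ_surjective _, (Submodule.ker_mkQ _).symm⟩

lemma RegularBijective.exists_hasInjectiveExtension {R : Type u} [CommRing R] [IsNoetherianRing R]
    (hK : Module.Injective R (FractionRing R)) {M : ModuleCat.{u} R} (hM : RegularBijective R M) :
    ∃ N : ModuleCat.{u} R, RegularBijective R N ∧ HasInjectiveExtension R N M := by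
  have hu (s : nonZeroDivisors R) : IsUnit (algebraMap R (Module.End R M) s) :=
    (Module.End.isUnit_iff _).mpr (hM s s.2)
  let l (m : M) : FractionRing R →ₗ[R] M :=
    IsLocalizedModule.lift (nonZeroDivisors R) (Algebra.linearMap R (FractionRing R))
      (LinearMap.toSpanSingleton R M m) hu
  have hl (m : M) : l m 1 = m := by
    have := LinearMap.congr_fun (IsLocalizedModule.lift_comp (nonZeroDivisors R)
      (Algebra.linearMap R (FractionRing R)) (LinearMap.toSpanSingleton R M m) hu) 1
    simpa using this
  let π : (M →₀ FractionRing R) →ₗ[R] M := Finsupp.lsum R l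
  have hF : RegularBijective R (M →₀ FractionRing R) := fun s hs ↦ by
    have hu := IsLocalization.map_units (FractionRing R) (⟨s, hs⟩ : nonZeroDivisors R)
    refine ⟨fun x y hxy ↦ Finsupp.ext fun m ↦ ?_, fun y ↦ ?_⟩
    · have := DFunLike.congr_fun hxy m
      simp only [Finsupp.smul_apply, Algebra.smul_def] at this
      exact hu.mul_left_cancel this
    · refine ⟨(↑hu.unit⁻¹ : FractionRing R) • y, ?_⟩
      dsimp only
      rw [← algebraMap_smul (FractionRing R) s, smul_smul, IsUnit.mul_val_inv, one_smul]
  refine ⟨ModuleCat.of R (LinearMap.ker π), fun s hs ↦ ⟨fun x y hxy ↦ ?_, fun y ↦ ?_⟩,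
    ModuleCat.of R (M →₀ FractionRing R), (LinearMap.ker π).subtype, π, hK.finsupp M,
    Submodule.subtype_injective _, fun m ↦ ⟨Finsupp.single m 1, by simp [π, hl]⟩,
    Submodule.range_subtype _⟩
  · exact Subtype.ext ((hF s hs).1 (Subtype.ext_iff.mp hxy))
  · obtain ⟨x, hx⟩ := (hF s hs).2 y.1
    refine ⟨⟨x, (hM s hs).1 ?_⟩, Subtype.ext hx⟩
    dsimp only at hx ⊢
    rw [← map_smul, hx, smul_zero]
    exact y.2

/-- Splicing short exact sequences with injective middle terms gives a complete injective
resolution. -/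
lemma GorensteinInjective.of_hasInjectiveExtension {R : Type u} [CommRing R]
    (Z : ℤ → ModuleCat.{u} R) (hZ : ∀ i, HasInjectiveExtension R (Z i) (Z (i + 1))) :
    GorensteinInjective R (Z 1) := by
  choose E ι π hE hι hπ hex using hZ
  have hrange (i : ℤ) : LinearMap.range (ι (i + 1) ∘ₗ π i) = LinearMap.range (ι (i + 1)) :=
    LinearMap.range_comp_of_range_eq_top _ (LinearMap.range_eq_top.mpr (hπ i))
  have hker (i : ℤ) : LinearMap.ker (ι (i + 1) ∘ₗ π i) = LinearMap.ker (π i) :=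
    LinearMap.ker_comp_of_ker_eq_bot _ (LinearMap.ker_eq_bot.mpr (hι (i + 1)))
  have hexct (i : ℤ) : LinearMap.range (ι (i + 1) ∘ₗ π i) =
      LinearMap.ker (ι (i + 1 + 1) ∘ₗ π (i + 1)) := by rw [hrange, hker, hex]
  refine ⟨{ E := fun i ↦ E i
            d := fun i ↦ ι (i + 1) ∘ₗ π i
            inj := hE
            exct := hexct
            homExact := fun I _ _ hI i g hg ↦ ?_ }, ⟨?_⟩⟩
  · have hle : LinearMap.ker (π (i + 1)) ≤ LinearMap.ker g := by
      rw [← hker, ← hexct, LinearMap.range_le_ker_iff]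
      exact hg
    obtain ⟨h, hh⟩ := hI.out (ι (i + 1 + 1)) (hι _)
      ((LinearMap.ker (π (i + 1))).liftQ g hle ∘ₗ
        ((π (i + 1)).quotKerEquivOfSurjective (hπ _)).symm.toLinearMap)
    refine ⟨h, LinearMap.ext fun x ↦ ?_⟩
    have hx : ((π (i + 1)).quotKerEquivOfSurjective (hπ _)).symm (π (i + 1) x) =
        (LinearMap.ker (π (i + 1))).mkQ x := by
      rw [LinearEquiv.symm_apply_eq]
      rfl
    rw [LinearMap.comp_apply, LinearMap.comp_apply, hh, LinearMap.comp_apply,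
      LinearEquiv.coe_coe, hx]
    rfl
  · exact (LinearEquiv.ofInjective _ (hι (0 + 1))).trans
      (LinearEquiv.ofEq _ _ (hrange 0).symm)

lemma RegularBijective.gorensteinInjective {R : Type u} [CommRing R] [IsNoetherianRing R]
    (hK : Module.Injective R (FractionRing R)) {M : Type u} [AddCommGroup M] [Module R M]
    (hM : RegularBijective R M) : GorensteinInjective R M := by
  choose next hnext using _root_.exists_hasInjectiveExtension (R := R)
  choose prev hprev hprev' using fun N : {N : ModuleCat.{u} R // RegularBijective R N} ↦
    N.2.exists_hasInjectiveExtension hK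
  let r : ℕ → ModuleCat.{u} R := fun n ↦ next^[n] (ModuleCat.of R M)
  let l : ℕ → {N : ModuleCat.{u} R // RegularBijective R N} := fun n ↦
    (fun N ↦ ⟨prev N, hprev N⟩)^[n] ⟨ModuleCat.of R M, hM⟩
  have hr (n : ℕ) : HasInjectiveExtension R (r n) (r (n + 1)) := by
    simp only [r, Function.iterate_succ_apply']
    exact hnext _
  have hl (n : ℕ) : HasInjectiveExtension R (l (n + 1)) (l n) := by
    simp only [l, Function.iterate_succ_apply']
    exact hprev' _
  let Z : ℤ → ModuleCat.{u} R
    | .ofNat 0 => l 1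
    | .ofNat (n + 1) => r n
    | .negSucc n => l (n + 2)
  refine GorensteinInjective.of_hasInjectiveExtension Z fun i ↦ ?_
  match i with
  | .ofNat 0 => exact hl 0
  | .ofNat (n + 1) => exact hr n
  | .negSucc 0 => exact hl 1
  | .negSucc (n + 1) => exact hl (n + 2)

lemma GorensteinInjective.smul_surjective {R : Type u} [CommRing R] {G : Type u} [AddCommGroup G]
    [Module R G] (hG : GorensteinInjective R G) {s : R} (hs : s ∈ nonZeroDivisors R) :
    Function.Surjective fun x : G ↦ s • x := by
  obtain ⟨X, ⟨e⟩⟩ := hG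
  let f : X.E 0 →ₗ[R] G := e.symm.toLinearMap ∘ₗ (X.d 0).rangeRestrict
  have hf : Function.Surjective f := e.symm.surjective.comp (X.d 0).surjective_rangeRestrict
  intro y
  obtain ⟨x, rfl⟩ := hf y
  obtain ⟨x, rfl⟩ := (X.inj 0).smul_surjective hs x
  exact ⟨f x, (map_smul f s x).symm⟩

/-- The tensor product of two modules that are divisible by nonzerodivisors is a module over the
total ring of fractions. -/
lemma RegularBijective.tensorProduct {R : Type u} [CommRing R] {G H : Type u} [AddCommGroup G]
    [Module R G] [AddCommGroup H] [Module R H]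
    (hG : ∀ s ∈ nonZeroDivisors R, Function.Surjective fun x : G ↦ s • x)
    (hH : ∀ s ∈ nonZeroDivisors R, Function.Surjective fun x : H ↦ s • x) :
    RegularBijective R (TensorProduct R G H) := by
  intro s hs
  let Γ := Submodule.torsion' R G (nonZeroDivisors R)
  have hbij : Function.Bijective (LinearMap.lsmul R (G ⧸ Γ) s) := by
    refine ⟨(injective_iff_map_eq_zero _).mpr fun x hx ↦ ?_, fun y ↦ ?_⟩
    · obtain ⟨x, rfl⟩ := Γ.mkQ_surjective x
      rw [LinearMap.lsmul_apply, ← map_smul, Submodule.mkQ_apply,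
        Submodule.Quotient.mk_eq_zero] at hx
      obtain ⟨t, ht⟩ := hx
      rw [Submodule.mkQ_apply, Submodule.Quotient.mk_eq_zero]
      exact ⟨t * ⟨s, hs⟩, by rw [mul_smul]; exact ht⟩
    · obtain ⟨y, rfl⟩ := Γ.mkQ_surjective y
      obtain ⟨x, rfl⟩ := hG s hs y
      exact ⟨Γ.mkQ x, (map_smul Γ.mkQ s x).symm⟩
  have hΓ : Subsingleton (TensorProduct R Γ H) := by
    refine subsingleton_of_forall_eq 0 fun w ↦ ?_
    induction w with
    | zero => rfl
    | add a b ha hb => rw [ha, hb, add_zero]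
    | tmul x y =>
      obtain ⟨t, ht⟩ := x.2
      obtain ⟨y, rfl⟩ := hH t t.2 y
      have htx : (t : R) • x = 0 := Subtype.ext ht
      dsimp only
      rw [← TensorProduct.smul_tmul, htx, TensorProduct.zero_tmul]
  have hrT : Function.Injective (Γ.mkQ.rTensor H) := by
    rw [injective_iff_map_eq_zero]
    intro z hz
    obtain ⟨w, rfl⟩ := (rTensor_exact H (LinearMap.exact_subtype_mkQ Γ)
      Γ.mkQ_surjective z).mp hz
    rw [Subsingleton.elim w 0, map_zero]
  have hS : Function.Injective (LinearMap.lsmul R (TensorProduct R (G ⧸ Γ) H) s) := by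
    have : LinearMap.lsmul R (TensorProduct R (G ⧸ Γ) H) s =
        (LinearEquiv.ofBijective _ hbij).toLinearMap.rTensor H := by
      ext x y
      simp [TensorProduct.smul_tmul']
    rw [this]
    exact ((LinearEquiv.ofBijective _ hbij).rTensor H).injective
  refine ⟨(injective_iff_map_eq_zero (LinearMap.lsmul R (TensorProduct R G H) s)).mpr
    fun z hz ↦ hrT (hS ?_), fun z ↦ ?_⟩
  · simp only [LinearMap.lsmul_apply] at hz ⊢
    rw [← map_smul, hz, map_zero, smul_zero]
  · induction z with
    | zero => exact ⟨0, smul_zero s⟩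
    | add a b ha hb =>
      obtain ⟨⟨a, rfl⟩, b, rfl⟩ := And.intro ha hb
      exact ⟨a + b, smul_add s a b⟩
    | tmul x y =>
      obtain ⟨x, rfl⟩ := hG s hs x
      exact ⟨TensorProduct.tmul R x y, TensorProduct.smul_tmul' s x y⟩

/-- Over a Cohen-Macaulay noetherian ring with a dualizing module which is
generically Gorenstein (i.e. `R_p` is Gorenstein for every minimal prime `p`), the tensor
product of two Gorenstein injective modules is Gorenstein injective. -/
theorem statement19 (R : Type u) [CommRing R] [IsNoetherianRing R]
    (hCM : IsCohenMacaulayRing R)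
    (D : Type u) [AddCommGroup D] [Module R D] (hD : IsDualizing R D)
    (hgen : ∀ (p : Ideal R) [p.IsPrime], p ∈ minimalPrimes R →
      IsGorensteinLocalRing (Localization.AtPrime p))
    (G H : Type u) [AddCommGroup G] [Module R G] [AddCommGroup H] [Module R H]
    (hG : GorensteinInjective R G) (hH : GorensteinInjective R H) :
    GorensteinInjective R (TensorProduct R G H) := by
  refine RegularBijective.gorensteinInjective (.of_isFractionRing _ fun p _ hp ↦ ?_)
    (.tensorProduct (fun _ ↦ hG.smul_surjective) fun _ ↦ hH.smul_surjective)
  have hmin := hCM.mem_minimalPrimes hp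
  obtain ⟨-, -, n, hn⟩ := hgen p hmin
  have : Ring.KrullDimLE 0 (Localization.AtPrime p) := by
    rw [Ring.krullDimLE_iff, IsLocalization.AtPrime.ringKrullDim_eq_height p,
      Ideal.height_eq_zero_iff.mpr hmin]
    rfl
  exact .of_isLocalization p.primeCompl (hn.injective n _)
end
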